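/- arXiv:1707.06321 — 12 statements merged into one kernel-verified Lean document; each statement's English description precedes it below -/
import Mathlib

section
/- Let α : I → ℝ³ be a C⁴ unit-speed curve in Euclidean 3-space equipped with a rotation minimizing frame {t, n₁, n₂} whose natural curvatures satisfy (κ₁κ₂′ − κ₁′κ₂)(s) ≠ 0 for all s ∈ I. Then α lies on a Euclidean sphere (i.e., there exist P ∈ ℝ³ and r > 0 with ‖α(s) − P‖ = r for all s) if and only if its normal development lies on a line not passing through the origin, i.e., there exist constants a₁, a₂ ∈ ℝ with a₁κ₁(s) + a₂κ₂(s) = 1 for all s ∈ I. -/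
open scoped RealInnerProductSpace

noncomputable section

abbrev E3 : Type := EuclideanSpace ℝ (Fin 3)

/-- A function whose derivative vanishes on an open interval is constant there. -/
theorem eq_of_hasDerivAt_zero_on_Ioo {F : Type*} [NormedAddCommGroup F] [NormedSpace ℝ F]
    {f : ℝ → F} {a b x y : ℝ} (hf : ∀ s ∈ Set.Ioo a b, HasDerivAt f 0 s)
    (hx : x ∈ Set.Ioo a b) (hy : y ∈ Set.Ioo a b) : f x = f y :=
  isOpen_Ioo.is_const_of_deriv_eq_zero isPreconnected_Ioo
    (fun s hs => (hf s hs).differentiableAt.differentiableWithinAt)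
    (fun s hs => (hf s hs).deriv) hx hy

/-- A C⁴ unit-speed curve in Euclidean 3-space with RM frame {t, n₁, n₂} and natural
curvatures κ₁, κ₂ satisfying (κ₁κ₂' - κ₁'κ₂) ≠ 0 lies on a sphere iff its normal
development lies on a line not passing through the origin. -/
theorem stmt_0
    (I : Set ℝ) (hI : ∃ a b : ℝ, I = Set.Ioo a b)
    (α t n₁ n₂ : ℝ → E3) (κ₁ κ₂ : ℝ → ℝ)
    (hα : ContDiff ℝ 4 α)
    (ht : ∀ s, t s = deriv α s)
    (horth : ∀ s ∈ I,
      ⟪t s, t s⟫ = 1 ∧ ⟪n₁ s, n₁ s⟫ = 1 ∧ ⟪n₂ s, n₂ s⟫ = 1 ∧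
      ⟪t s, n₁ s⟫ = 0 ∧ ⟪t s, n₂ s⟫ = 0 ∧ ⟪n₁ s, n₂ s⟫ = 0)
    (hn₁d : ∀ s ∈ I, DifferentiableAt ℝ n₁ s)
    (hn₂d : ∀ s ∈ I, DifferentiableAt ℝ n₂ s)
    (hκ₁d : ∀ s ∈ I, DifferentiableAt ℝ κ₁ s)
    (hκ₂d : ∀ s ∈ I, DifferentiableAt ℝ κ₂ s)
    (hframe : ∀ s ∈ I, deriv t s = κ₁ s • n₁ s + κ₂ s • n₂ s)
    (hrm₁ : ∀ s ∈ I, deriv n₁ s = (-(κ₁ s)) • t s)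
    (hrm₂ : ∀ s ∈ I, deriv n₂ s = (-(κ₂ s)) • t s)
    (hnd : ∀ s ∈ I, κ₁ s * deriv κ₂ s - deriv κ₁ s * κ₂ s ≠ 0) :
    (∃ P : E3, ∃ r : ℝ, 0 < r ∧ ∀ s ∈ I, ‖α s - P‖ = r) ↔
      (∃ a₁ a₂ : ℝ, ∀ s ∈ I, a₁ * κ₁ s + a₂ * κ₂ s = 1) := by
  obtain ⟨a, b, rfl⟩ := hI
  have hαd : ∀ s, HasDerivAt α (t s) s := fun s => by
    rw [ht]
    exact (hα.differentiable (by norm_num) s).hasDerivAt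
  have htd : ∀ s ∈ Set.Ioo a b, HasDerivAt t (κ₁ s • n₁ s + κ₂ s • n₂ s) s := fun s hs => by
    rw [← hframe s hs, funext ht]
    have h : ContDiff ℝ 3 (deriv α) := ContDiff.deriv' (by exact_mod_cast hα)
    exact (h.differentiable (by norm_num) s).hasDerivAt
  have hd₁ : ∀ s ∈ Set.Ioo a b, HasDerivAt n₁ (-(κ₁ s) • t s) s := fun s hs =>
    hrm₁ s hs ▸ (hn₁d s hs).hasDerivAt
  have hd₂ : ∀ s ∈ Set.Ioo a b, HasDerivAt n₂ (-(κ₂ s) • t s) s := fun s hs =>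
    hrm₂ s hs ▸ (hn₂d s hs).hasDerivAt
  rcases (Set.Ioo a b).eq_empty_or_nonempty with hempty | ⟨s₀, hs₀⟩
  · simp only [hempty, Set.mem_empty_iff_false, false_imp_iff, implies_true, and_true, exists_const]
    exact ⟨fun _ => trivial, fun _ => ⟨1, one_pos⟩⟩
  constructor
  · rintro ⟨P, r, -, hr⟩
    have hsub : ∀ s, HasDerivAt (fun u => α u - P) (t s) s := fun s => (hαd s).sub_const P
    have htan : ∀ s ∈ Set.Ioo a b, ⟪α s - P, t s⟫ = 0 := fun s hs => by
      have h := (hsub s).inner ℝ (hsub s)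
      have hc : (fun u => ⟪α u - P, α u - P⟫) =ᶠ[nhds s] fun _ => r ^ 2 := by
        filter_upwards [isOpen_Ioo.mem_nhds hs] with u hu
        rw [real_inner_self_eq_norm_sq, hr u hu]
      have h0 := h.unique ((hasDerivAt_const s (r ^ 2)).congr_of_eventuallyEq hc)
      rw [real_inner_comm (α s - P) (t s)] at h0
      linarith
    have hnorm : ∀ s ∈ Set.Ioo a b,
        κ₁ s * ⟪α s - P, n₁ s⟫ + κ₂ s * ⟪α s - P, n₂ s⟫ = -1 := fun s hs => by
      have h := (hsub s).inner ℝ (htd s hs)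
      have hc : (fun u => ⟪α u - P, t u⟫) =ᶠ[nhds s] fun _ => 0 := by
        filter_upwards [isOpen_Ioo.mem_nhds hs] with u hu using htan u hu
      have h0 := h.unique ((hasDerivAt_const s (0 : ℝ)).congr_of_eventuallyEq hc)
      rw [inner_add_right, inner_smul_right, inner_smul_right, (horth s hs).1] at h0
      linarith
    have hc₁ : ∀ s ∈ Set.Ioo a b, HasDerivAt (fun u => ⟪α u - P, n₁ u⟫) 0 s := fun s hs => by
      have h := (hsub s).inner ℝ (hd₁ s hs)
      rwa [inner_smul_right, htan s hs, (horth s hs).2.2.2.1, mul_zero, add_zero] at h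
    have hc₂ : ∀ s ∈ Set.Ioo a b, HasDerivAt (fun u => ⟪α u - P, n₂ u⟫) 0 s := fun s hs => by
      have h := (hsub s).inner ℝ (hd₂ s hs)
      rwa [inner_smul_right, htan s hs, (horth s hs).2.2.2.2.1, mul_zero, add_zero] at h
    refine ⟨-⟪α s₀ - P, n₁ s₀⟫, -⟪α s₀ - P, n₂ s₀⟫, fun s hs => ?_⟩
    have h₁ := eq_of_hasDerivAt_zero_on_Ioo hc₁ hs₀ hs
    have h₂ := eq_of_hasDerivAt_zero_on_Ioo hc₂ hs₀ hs
    rw [h₁, h₂]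
    linarith [hnorm s hs]
  · rintro ⟨a₁, a₂, hline⟩
    have hcenter : ∀ s ∈ Set.Ioo a b,
        HasDerivAt (fun u => α u + (a₁ • n₁ u + a₂ • n₂ u)) 0 s := fun s hs => by
      have h := (hαd s).add (((hd₁ s hs).const_smul a₁).add ((hd₂ s hs).const_smul a₂))
      have h0 : t s + (a₁ • -(κ₁ s) • t s + a₂ • -(κ₂ s) • t s) = 0 := by
        have h1 : t s + (a₁ • -(κ₁ s) • t s + a₂ • -(κ₂ s) • t s)
            = (1 - (a₁ * κ₁ s + a₂ * κ₂ s)) • t s := by module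
        rw [h1, hline s hs, sub_self, zero_smul]
      rw [h0] at h
      exact h
    have hpos : 0 < a₁ ^ 2 + a₂ ^ 2 := by
      by_contra hneg
      have h₁ : a₁ = 0 := by nlinarith [sq_nonneg a₁, sq_nonneg a₂]
      have h₂ : a₂ = 0 := by nlinarith [sq_nonneg a₁, sq_nonneg a₂]
      simpa [h₁, h₂] using hline s₀ hs₀
    refine ⟨α s₀ + (a₁ • n₁ s₀ + a₂ • n₂ s₀), √(a₁ ^ 2 + a₂ ^ 2), Real.sqrt_pos.2 hpos,
      fun s hs => ?_⟩
    have hP := eq_of_hasDerivAt_zero_on_Ioo hcenter hs₀ hs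
    obtain ⟨-, h₁₁, h₂₂, -, -, h₁₂⟩ := horth s hs
    rw [hP, sub_add_cancel_left, norm_neg, ← Real.sqrt_sq (norm_nonneg _),
      ← real_inner_self_eq_norm_sq]
    congr 1
    simp only [inner_add_left, inner_add_right, real_inner_smul_left, real_inner_smul_right,
      h₁₁, h₂₂, h₁₂, real_inner_comm (n₁ s) (n₂ s)]
    ring
end
end

section
/- Let α : I → ℝ³ be a unit-speed admissible curve in the simply isotropic space I³ with Frenet frame {t, n, b}, curvature κ, and torsion τ, and fix s₀ ∈ I. If n₁ is a vector field along α with ⟨n₁, t⟩_z = 0, ⟨n₁, n₁⟩_z = 1, det(t, n₁, b) = 1, and n₁ is rotation minimizing, then there exists a constant τ₀ ∈ ℝ such that n₁(s) = n(s) − (∫_{s₀}^{s} τ(x) dx + τ₀) b for all s ∈ I. -/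
noncomputable section

abbrev V3 : Type := ℝ × ℝ × ℝ

/-- The simply isotropic inner product ⟨u,v⟩_z = u₁v₁ + u₂v₂. -/
def innerZ (u v : V3) : ℝ := u.1 * v.1 + u.2.1 * v.2.1

/-- Determinant of the three vectors u, v, w taken as rows. -/
def det3 (u v w : V3) : ℝ :=
    u.1 * (v.2.1 * w.2.2 - v.2.2 * w.2.1)
  - u.2.1 * (v.1 * w.2.2 - v.2.2 * w.1)
  + u.2.2 * (v.1 * w.2.1 - v.2.1 * w.1)

/-- The derivative of a curve in `V3` is computed coordinatewise. -/
theorem deriv_curve_V3 {f g h : ℝ → ℝ} (hf : Differentiable ℝ f) (hg : Differentiable ℝ g)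
    (hh : Differentiable ℝ h) :
    deriv (fun s => ((f s, g s, h s) : V3)) = fun s => (deriv f s, deriv g s, deriv h s) :=
  funext fun s => ((hf s).hasDerivAt.prodMk ((hg s).hasDerivAt.prodMk (hh s).hasDerivAt)).deriv

/-- The acceleration of a unit-speed plane curve is its velocity rotated by a right angle and scaled
by the signed curvature. -/
theorem deriv_deriv_of_unit_speed {x y : ℝ → ℝ} {U : Set ℝ} (hU : IsOpen U)
    (hx : Differentiable ℝ (deriv x)) (hy : Differentiable ℝ (deriv y))
    (hunit : ∀ s ∈ U, deriv x s ^ 2 + deriv y s ^ 2 = 1) {s : ℝ} (hs : s ∈ U) :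
    deriv (deriv x) s
        = -(deriv x s * deriv (deriv y) s - deriv (deriv x) s * deriv y s) * deriv y s ∧
      deriv (deriv y) s
        = (deriv x s * deriv (deriv y) s - deriv (deriv x) s * deriv y s) * deriv x s := by
  have hconst : (fun u => deriv x u ^ 2 + deriv y u ^ 2) =ᶠ[nhds s] fun _ => (1 : ℝ) := by
    filter_upwards [hU.mem_nhds hs] with u hu using hunit u hu
  have horth : deriv x s * deriv (deriv x) s + deriv y s * deriv (deriv y) s = 0 := by
    have h := (((hx s).hasDerivAt.pow 2).add ((hy s).hasDerivAt.pow 2)).unique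
      ((hasDerivAt_const s (1 : ℝ)).congr_of_eventuallyEq hconst)
    norm_num at h
    linarith
  have h1 := hunit s hs
  constructor
  · linear_combination (-deriv (deriv x) s) * h1 + deriv x s * horth
  · linear_combination (-deriv (deriv y) s) * h1 + deriv y s * horth

/-- In the plane, a vector `(p, q)` orthogonal to the unit vector `(v, w)` and positively oriented
with respect to it, with unit area, is `(-w, v)`. -/
theorem eq_rotation_of_orthogonal {v w p q : ℝ} (hunit : v ^ 2 + w ^ 2 = 1)
    (horth : p * v + q * w = 0) (hdet : v * q - w * p = 1) : p = -w ∧ q = v := by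
  constructor
  · linear_combination (-p) * hunit + v * horth - w * hdet
  · linear_combination (-q) * hunit + w * horth + v * hdet

/-- If the first two coordinates of `D` vanish on an open set and `D` has derivative `ν t + τ b`, with
`t` of unit isotropic length and `b = (0, 0, 1)`, then the derivative is `τ b`. -/
theorem hasDerivAt_vertical {D : ℝ → V3} {U : Set ℝ} (hU : IsOpen U)
    (h1 : ∀ s ∈ U, (D s).1 = 0) (h2 : ∀ s ∈ U, (D s).2.1 = 0) {s : ℝ} (hs : s ∈ U)
    {ν τ : ℝ} {t : V3} (ht : t.1 ^ 2 + t.2.1 ^ 2 = 1)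
    (hD : HasDerivAt D (ν • t + τ • ((0, 0, 1) : V3)) s) :
    HasDerivAt D (τ • ((0, 0, 1) : V3)) s := by
  have e1 : (fun u => (D u).1) =ᶠ[nhds s] fun _ => (0 : ℝ) := by
    filter_upwards [hU.mem_nhds hs] with u hu using h1 u hu
  have e2 : (fun u => (D u).2.1) =ᶠ[nhds s] fun _ => (0 : ℝ) := by
    filter_upwards [hU.mem_nhds hs] with u hu using h2 u hu
  have z1 := (show HasDerivAt (fun u => (D u).1) _ s from hD.hasFDerivAt.fst.hasDerivAt).unique
    ((hasDerivAt_const s (0 : ℝ)).congr_of_eventuallyEq e1)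
  have z2 := (show HasDerivAt (fun u => (D u).2.1) _ s from
    hD.hasFDerivAt.snd.fst.hasDerivAt).unique
    ((hasDerivAt_const s (0 : ℝ)).congr_of_eventuallyEq e2)
  simp at z1 z2
  have hν : ν = 0 := by
    by_contra hne
    simp only [hne, false_or] at z1 z2
    norm_num [z1, z2] at ht
  simpa [hν] using hD

/-- A rotation minimizing unit normal field n₁ along a unit-speed admissible curve in the
simply isotropic space I³ (with the correct orientation) equals n - (∫ τ + τ₀) b. -/
theorem stmt_2
    (I : Set ℝ) (hI : ∃ a b : ℝ, I = Set.Ioo a b)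
    (α : ℝ → V3) (hα : ContDiff ℝ (⊤ : ℕ∞) α)
    (x y z : ℝ → ℝ) (hcomp : ∀ s, α s = (x s, y s, z s))
    (hunit : ∀ s ∈ I, (deriv x s) ^ 2 + (deriv y s) ^ 2 = 1)
    (κ : ℝ → ℝ)
    (hκdef : ∀ s, κ s = deriv x s * deriv (deriv y) s - deriv (deriv x) s * deriv y s)
    (hadm : ∀ s ∈ I, κ s ≠ 0)
    (t : ℝ → V3) (ht : ∀ s, t s = deriv α s)
    (b : V3) (hb : b = ((0 : ℝ), (0 : ℝ), (1 : ℝ)))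
    (n : ℝ → V3) (hn : ∀ s, n s = (κ s)⁻¹ • deriv t s)
    (τ : ℝ → ℝ) (hτ : ∀ s ∈ I, deriv n s = (-(κ s)) • t s + τ s • b)
    (hτc : Continuous τ)
    (s₀ : ℝ) (hs₀ : s₀ ∈ I)
    (n₁ : ℝ → V3) (hn₁d : ∀ s ∈ I, DifferentiableAt ℝ n₁ s)
    (hn₁t : ∀ s ∈ I, innerZ (n₁ s) (t s) = 0)
    (hn₁n₁ : ∀ s ∈ I, innerZ (n₁ s) (n₁ s) = 1)
    (hdet : ∀ s ∈ I, det3 (t s) (n₁ s) b = 1)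
    (hRM : ∀ s ∈ I, ∃ μ : ℝ, deriv n₁ s = μ • t s) :
    ∃ τ₀ : ℝ, ∀ s ∈ I, n₁ s = n s - ((∫ u in s₀..s, τ u) + τ₀) • b := by
  obtain ⟨a, c, rfl⟩ := hI
  subst hb
  have hx : ContDiff ℝ (⊤ : ℕ∞) x := by
    simpa [hcomp] using hα.fst
  have hy : ContDiff ℝ (⊤ : ℕ∞) y := by
    simpa [hcomp] using hα.snd.fst
  have hz : ContDiff ℝ (⊤ : ℕ∞) z := by
    simpa [hcomp] using hα.snd.snd
  have hx' := (contDiff_infty_iff_deriv.1 hx).2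
  have hy' := (contDiff_infty_iff_deriv.1 hy).2
  have hz' := (contDiff_infty_iff_deriv.1 hz).2
  have hx'' := (contDiff_infty_iff_deriv.1 hx').2
  have hy'' := (contDiff_infty_iff_deriv.1 hy').2
  have hz'' := (contDiff_infty_iff_deriv.1 hz').2
  have hdiff {f : ℝ → ℝ} (hf : ContDiff ℝ (⊤ : ℕ∞) f) : Differentiable ℝ f :=
    (contDiff_infty_iff_deriv.1 hf).1
  have hteq : t = fun s => (deriv x s, deriv y s, deriv z s) := by
    rw [← deriv_curve_V3 (hdiff hx) (hdiff hy) (hdiff hz), ← funext hcomp]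
    exact funext ht
  have hneq : n = fun s =>
      (κ s)⁻¹ • ((deriv (deriv x) s, deriv (deriv y) s, deriv (deriv z) s) : V3) := by
    funext s
    rw [hn, hteq, deriv_curve_V3 (hdiff hx') (hdiff hy') (hdiff hz')]
  have hκ : Differentiable ℝ κ := by
    rw [funext hκdef]
    exact ((hdiff hx').mul (hdiff hy'')).sub ((hdiff hx'').mul (hdiff hy'))
  have hnd : ∀ s ∈ Set.Ioo a c, DifferentiableAt ℝ n s := by
    intro s hs
    rw [hneq]
    exact ((hκ s).inv (hadm s hs)).smul
      ((hdiff hx'' s).prodMk ((hdiff hy'' s).prodMk (hdiff hz'' s)))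
  have hhor : ∀ s ∈ Set.Ioo a c, (n s - n₁ s).1 = 0 ∧ (n s - n₁ s).2.1 = 0 := by
    intro s hs
    obtain ⟨k1, k2⟩ := deriv_deriv_of_unit_speed isOpen_Ioo (hdiff hx') (hdiff hy') hunit hs
    rw [← hκdef] at k1 k2
    obtain ⟨p1, p2⟩ := eq_rotation_of_orthogonal (p := (n₁ s).1) (q := (n₁ s).2.1) (hunit s hs)
      (by simpa [innerZ, hteq] using hn₁t s hs) (by simpa [det3, hteq] using hdet s hs)
    have hk := hadm s hs
    have m1 : (n s).1 = -deriv y s := by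
      simp only [hneq, Prod.smul_fst, smul_eq_mul, k1]
      field_simp
    have m2 : (n s).2.1 = deriv x s := by
      simp only [hneq, Prod.smul_fst, Prod.smul_snd, smul_eq_mul, k2]
      field_simp
    simp [p1, p2, m1, m2]
  have hD : ∀ s ∈ Set.Ioo a c,
      HasDerivAt (fun u => n u - n₁ u) (τ s • ((0, 0, 1) : V3)) s := by
    intro s hs
    obtain ⟨μ, hμ⟩ := hRM s hs
    refine hasDerivAt_vertical isOpen_Ioo (fun u hu => (hhor u hu).1) (fun u hu => (hhor u hu).2) hs
      (ν := -κ s - μ) (t := t s) (by simpa [hteq] using hunit s hs) ?_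
    have h := (hnd s hs).hasDerivAt.sub (hn₁d s hs).hasDerivAt
    rw [hτ s hs, hμ] at h
    have hcomb : (-κ s - μ) • t s + τ s • ((0, 0, 1) : V3)
        = -κ s • t s + τ s • ((0, 0, 1) : V3) - μ • t s := by
      module
    rw [hcomb]
    exact h
  have hE : ∀ s ∈ Set.Ioo a c, HasDerivAt
      (fun u => n u - n₁ u - (∫ v in s₀..u, τ v) • ((0, 0, 1) : V3)) 0 s := by
    intro s hs
    have hint := (hτc.integral_hasStrictDerivAt s₀ s).hasDerivAt.smul_const ((0, 0, 1) : V3)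
    have h := (hD s hs).sub hint
    rw [sub_self] at h
    exact h
  refine ⟨(n s₀ - n₁ s₀).2.2, fun s hs => ?_⟩
  have hconst := isOpen_Ioo.is_const_of_deriv_eq_zero isPreconnected_Ioo
    (fun u hu => (hE u hu).differentiableAt.differentiableWithinAt)
    (fun u hu => (hE u hu).deriv) hs hs₀
  have hvert : n s₀ - n₁ s₀ = (n s₀ - n₁ s₀).2.2 • ((0, 0, 1) : V3) := by
    obtain ⟨h1, h2⟩ := hhor s₀ hs₀
    ext <;> simp_all
  simp only [intervalIntegral.integral_same, zero_smul, sub_zero] at hconst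
  rw [add_smul, ← hvert, ← hconst]
  abel
end
end

section
/- Let α : I → ℝ³ be a unit-speed admissible curve in the simply isotropic space I³, and let {t, n₁, n₂ = b} be an RM frame along α, so that n₁(s) = n(s) − θ(s) b with θ(s) = ∫_{s₀}^{s} τ + τ₀. Then the frame satisfies t′ = κ₁ n₁ + κ₂ n₂, n₁′ = −κ₁ t, and n₂′ = 0, where the natural curvatures are κ₁ = κ and κ₂ = κ·θ (in particular θ′ = τ and κ₁κ₂′ − κ₁′κ₂ = τκ²). -/
noncomputable section

/-- The RM frame {t, n₁, n₂ = b} along a unit-speed admissible curve in I³ satisfies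
t' = κ₁ n₁ + κ₂ n₂, n₁' = -κ₁ t, n₂' = 0 with κ₁ = κ, κ₂ = κ·θ; moreover θ' = τ and
κ₁κ₂' - κ₁'κ₂ = τκ². -/
theorem stmt_3
    (I : Set ℝ) (hI : ∃ a b : ℝ, I = Set.Ioo a b)
    (α : ℝ → V3) (hα : ContDiff ℝ (⊤ : ℕ∞) α)
    (x y z : ℝ → ℝ) (hcomp : ∀ s, α s = (x s, y s, z s))
    (hunit : ∀ s ∈ I, (deriv x s) ^ 2 + (deriv y s) ^ 2 = 1)
    (κ : ℝ → ℝ)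
    (hκdef : ∀ s, κ s = deriv x s * deriv (deriv y) s - deriv (deriv x) s * deriv y s)
    (hadm : ∀ s ∈ I, κ s ≠ 0)
    (t : ℝ → V3) (ht : ∀ s, t s = deriv α s)
    (b : V3) (hb : b = ((0 : ℝ), (0 : ℝ), (1 : ℝ)))
    (n : ℝ → V3) (hn : ∀ s, n s = (κ s)⁻¹ • deriv t s)
    (τ : ℝ → ℝ) (hτ : ∀ s ∈ I, deriv n s = (-(κ s)) • t s + τ s • b)
    (hτc : Continuous τ)
    (s₀ : ℝ) (hs₀ : s₀ ∈ I) (τ₀ : ℝ)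
    (θ : ℝ → ℝ) (hθ : ∀ s, θ s = (∫ u in s₀..s, τ u) + τ₀)
    (n₁ : ℝ → V3) (hn₁ : ∀ s, n₁ s = n s - θ s • b) :
    ∀ s ∈ I,
      deriv t s = κ s • n₁ s + (κ s * θ s) • b ∧
      deriv n₁ s = (-(κ s)) • t s ∧
      deriv (fun _ : ℝ => b) s = (0 : V3) ∧
      deriv θ s = τ s ∧
      κ s * deriv (fun u => κ u * θ u) s - deriv κ s * (κ s * θ s) = τ s * κ s ^ 2 := by
  have hx : ContDiff ℝ (⊤ : ℕ∞) x := by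
    have h : x = fun s => (α s).1 := by funext s; rw [hcomp]
    rw [h]; exact hα.fst
  have hy : ContDiff ℝ (⊤ : ℕ∞) y := by
    have h : y = fun s => (α s).2.1 := by funext s; rw [hcomp]
    rw [h]; exact hα.snd.fst
  have hx' := (contDiff_infty_iff_deriv.1 hx).2
  have hy' := (contDiff_infty_iff_deriv.1 hy).2
  have hκ : Differentiable ℝ κ := by
    rw [funext hκdef]
    exact ((hx'.mul (contDiff_infty_iff_deriv.1 hy').2).sub
      ((contDiff_infty_iff_deriv.1 hx').2.mul hy')).differentiable (by simp)
  have ht' : Differentiable ℝ (deriv t) := by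
    rw [show t = deriv α from funext ht]
    exact (contDiff_infty_iff_deriv.1 (contDiff_infty_iff_deriv.1 hα).2).2.differentiable (by simp)
  have hθ' : ∀ s, HasDerivAt θ (τ s) s := fun s => by
    rw [funext hθ]
    exact (hτc.integral_hasStrictDerivAt s₀ s).hasDerivAt.add_const τ₀
  intro s hs
  have hκs := hadm s hs
  have hn' : HasDerivAt n ((-(κ s)) • t s + τ s • b) s := by
    rw [← hτ s hs, hasDerivAt_deriv_iff, funext hn]
    exact ((hκ s).inv hκs).smul (ht' s)
  refine ⟨?_, ?_, deriv_const s b, (hθ' s).deriv, ?_⟩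
  · rw [hn₁, hn, smul_sub, smul_inv_smul₀ hκs, smul_smul, sub_add_cancel]
  · rw [funext hn₁, (hn'.fun_sub ((hθ' s).smul_const b)).deriv, add_sub_cancel_right]
  · rw [((hκ s).hasDerivAt.fun_mul (hθ' s)).deriv]
    ring
end
end

section
/- Let α : I → ℝ³ be a unit-speed admissible curve in the simply isotropic space I³ with Frenet frame {t, n, b} and torsion τ, and fix s₀ ∈ I and a constant c ∈ ℝ. Then the vector field n₁(s) := n(s) − (∫_{s₀}^{s} τ(x) dx + c) b satisfies ⟨n₁, t⟩_z = 0, ⟨n₁, n₁⟩_z = 1, det(t, n₁, b) = 1, and n₁ is rotation minimizing (indeed n₁′ = −κ t). -/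
noncomputable section

/-- The derivative of a curve in `V3` is computed componentwise. -/
theorem deriv_V3 {f g h : ℝ → ℝ} {s : ℝ} (hf : DifferentiableAt ℝ f s)
    (hg : DifferentiableAt ℝ g s) (hh : DifferentiableAt ℝ h s) :
    deriv (fun u => ((f u, g u, h u) : V3)) s = (deriv f s, deriv g s, deriv h s) :=
  (hf.hasDerivAt.prodMk (hg.hasDerivAt.prodMk hh.hasDerivAt)).deriv

/-- A planar vector field which is of unit length on an open set is orthogonal there to its
derivative. -/
theorem mul_deriv_add_mul_deriv_eq_zero {p q : ℝ → ℝ} {I : Set ℝ} (hI : IsOpen I)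
    (hpq : ∀ s ∈ I, p s ^ 2 + q s ^ 2 = 1) {s : ℝ} (hs : s ∈ I)
    (hp : DifferentiableAt ℝ p s) (hq : DifferentiableAt ℝ q s) :
    p s * deriv p s + q s * deriv q s = 0 := by
  have hconst : (fun u => p u ^ 2 + q u ^ 2) =ᶠ[nhds s] fun _ => (1 : ℝ) :=
    Filter.eventuallyEq_of_mem (hI.mem_nhds hs) hpq
  have hd := ((hp.hasDerivAt.pow 2).add (hq.hasDerivAt.pow 2)).unique
    ((hasDerivAt_const s (1 : ℝ)).congr_of_eventuallyEq hconst)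
  norm_num at hd
  linarith

/-- The vector field n₁ = n - (∫ τ + c) b along a unit-speed admissible curve in I³ is a
rotation minimizing unit normal field with det(t, n₁, b) = 1; indeed n₁' = -κ t. -/
theorem stmt_4
    (I : Set ℝ) (hI : ∃ a b : ℝ, I = Set.Ioo a b)
    (α : ℝ → V3) (hα : ContDiff ℝ (⊤ : ℕ∞) α)
    (x y z : ℝ → ℝ) (hcomp : ∀ s, α s = (x s, y s, z s))
    (hunit : ∀ s ∈ I, (deriv x s) ^ 2 + (deriv y s) ^ 2 = 1)
    (κ : ℝ → ℝ)
    (hκdef : ∀ s, κ s = deriv x s * deriv (deriv y) s - deriv (deriv x) s * deriv y s)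
    (hadm : ∀ s ∈ I, κ s ≠ 0)
    (t : ℝ → V3) (ht : ∀ s, t s = deriv α s)
    (b : V3) (hb : b = ((0 : ℝ), (0 : ℝ), (1 : ℝ)))
    (n : ℝ → V3) (hn : ∀ s, n s = (κ s)⁻¹ • deriv t s)
    (τ : ℝ → ℝ) (hτ : ∀ s ∈ I, deriv n s = (-(κ s)) • t s + τ s • b)
    (hτc : Continuous τ)
    (s₀ : ℝ) (hs₀ : s₀ ∈ I) (c : ℝ)
    (n₁ : ℝ → V3) (hn₁ : ∀ s, n₁ s = n s - ((∫ u in s₀..s, τ u) + c) • b) :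
    ∀ s ∈ I,
      innerZ (n₁ s) (t s) = 0 ∧
      innerZ (n₁ s) (n₁ s) = 1 ∧
      det3 (t s) (n₁ s) b = 1 ∧
      deriv n₁ s = (-(κ s)) • t s := by
  obtain ⟨a₀, b₀, rfl⟩ := hI
  obtain rfl : α = fun s => (x s, y s, z s) := funext hcomp
  have hx : ContDiff ℝ (⊤ : ℕ∞) x := hα.fst
  have hy : ContDiff ℝ (⊤ : ℕ∞) y := hα.snd.fst
  have hz : ContDiff ℝ (⊤ : ℕ∞) z := hα.snd.snd
  have hsmooth : ∀ {f : ℝ → ℝ}, ContDiff ℝ (⊤ : ℕ∞) f → ContDiff ℝ (⊤ : ℕ∞) (deriv f) :=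
    fun hf => (contDiff_infty_iff_deriv.1 hf).2
  have hdiff : ∀ {f : ℝ → ℝ}, ContDiff ℝ (⊤ : ℕ∞) f → Differentiable ℝ f :=
    fun hf => (contDiff_infty_iff_deriv.1 hf).1
  have hx' := hsmooth hx
  have hy' := hsmooth hy
  have hz' := hsmooth hz
  obtain rfl : t = fun s => (deriv x s, deriv y s, deriv z s) := funext fun s =>
    (ht s).trans (deriv_V3 (hdiff hx s) (hdiff hy s) (hdiff hz s))
  obtain rfl : n = fun s =>
      (κ s)⁻¹ • ((deriv (deriv x) s, deriv (deriv y) s, deriv (deriv z) s) : V3) :=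
    funext fun s => (hn s).trans
      (congrArg _ (deriv_V3 (hdiff hx' s) (hdiff hy' s) (hdiff hz' s)))
  obtain rfl := funext hn₁
  obtain rfl := funext hκdef
  subst hb
  intro s hs
  have horth := mul_deriv_add_mul_deriv_eq_zero isOpen_Ioo hunit hs (hdiff hx' s) (hdiff hy' s)
  have hu := hunit s hs
  have hκ := hadm s hs
  have hderiv := hτ s hs
  have hx₂ := hdiff (hsmooth hx') s
  have hy₂ := hdiff (hsmooth hy') s
  have hz₂ := hdiff (hsmooth hz') s
  have hκdiff : DifferentiableAt ℝ
      (fun s => deriv x s * deriv (deriv y) s - deriv (deriv x) s * deriv y s) s :=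
    ((hdiff hx' s).mul hy₂).sub (hx₂.mul (hdiff hy' s))
  have hndiff := (hκdiff.fun_inv hκ).fun_smul (hx₂.prodMk (hy₂.prodMk hz₂))
  have hint := ((hτc.integral_hasStrictDerivAt s₀ s).hasDerivAt.add_const c).smul_const
    (((0 : ℝ), (0 : ℝ), (1 : ℝ)) : V3)
  have hx_frenet : deriv (deriv x) s =
      -((deriv x s * deriv (deriv y) s - deriv (deriv x) s * deriv y s) * deriv y s) := by
    linear_combination (-deriv (deriv x) s) * hu + deriv x s * horth
  have hy_frenet : deriv (deriv y) s =
      (deriv x s * deriv (deriv y) s - deriv (deriv x) s * deriv y s) * deriv x s := by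
    linear_combination (-deriv (deriv y) s) * hu + deriv y s * horth
  have hn_fst : (deriv x s * deriv (deriv y) s - deriv (deriv x) s * deriv y s)⁻¹ *
      deriv (deriv x) s = -deriv y s := by
    rw [inv_mul_eq_iff_eq_mul₀ hκ]
    linear_combination hx_frenet
  have hn_snd : (deriv x s * deriv (deriv y) s - deriv (deriv x) s * deriv y s)⁻¹ *
      deriv (deriv y) s = deriv x s := by
    rw [inv_mul_eq_iff_eq_mul₀ hκ]
    exact hy_frenet
  refine ⟨?_, ?_, ?_, ?_⟩
  · simp only [innerZ, Prod.fst_sub, Prod.snd_sub, Prod.smul_fst, Prod.smul_snd, smul_eq_mul,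
      hn_fst, hn_snd]
    ring
  · simp only [innerZ, Prod.fst_sub, Prod.snd_sub, Prod.smul_fst, Prod.smul_snd, smul_eq_mul,
      hn_fst, hn_snd]
    linear_combination hu
  · simp only [det3, Prod.fst_sub, Prod.snd_sub, Prod.smul_fst, Prod.smul_snd, smul_eq_mul,
      hn_fst, hn_snd]
    linear_combination hu
  · refine (hndiff.hasDerivAt.sub hint).deriv.trans ?_
    rw [hderiv, add_sub_cancel_right]
end
end

section
/- Let α : I → ℝ³ be a unit-speed admissible curve in the simply isotropic space I³ with RM frame {t, n₁, n₂ = b} and natural curvatures κ₁, κ₂, and define the RM bivectors via the Euclidean cross product: 𝒯 = n₁ × n₂, 𝒩₁ = n₂ × t, 𝒩₂ = t × n₁. Then {𝒯, 𝒩₁, 𝒩₂} is a basis of ℝ³ with det(𝒯, 𝒩₁, 𝒩₂) = 1, and the frame satisfies 𝒯′ = κ₁ 𝒩₁, 𝒩₁′ = −κ₁ 𝒯, and 𝒩₂′ = −κ₂ 𝒯. -/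
noncomputable section

/-- The Euclidean cross product on ℝ³. -/
def crossE (u v : V3) : V3 :=
  (u.2.1 * v.2.2 - u.2.2 * v.2.1, u.2.2 * v.1 - u.1 * v.2.2, u.1 * v.2.1 - u.2.1 * v.1)

theorem HasDerivAt.coordinates {u : ℝ → V3} {u' : V3} {s : ℝ} (hu : HasDerivAt u u' s) :
    HasDerivAt (fun r => (u r).1) u'.1 s ∧ HasDerivAt (fun r => (u r).2.1) u'.2.1 s ∧
      HasDerivAt (fun r => (u r).2.2) u'.2.2 s := by
  refine ⟨?_, ?_, ?_⟩
  · simpa using hu.hasFDerivAt.fst.hasDerivAt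
  · simpa using hu.hasFDerivAt.snd.fst.hasDerivAt
  · simpa using hu.hasFDerivAt.snd.snd.hasDerivAt

theorem HasDerivAt.crossE {u v : ℝ → V3} {u' v' : V3} {s : ℝ}
    (hu : HasDerivAt u u' s) (hv : HasDerivAt v v' s) :
    HasDerivAt (fun r => crossE (u r) (v r)) (crossE u' (v s) + crossE (u s) v') s := by
  obtain ⟨hu₁, hu₂, hu₃⟩ := hu.coordinates
  obtain ⟨hv₁, hv₂, hv₃⟩ := hv.coordinates
  refine (((hu₂.mul hv₃).sub (hu₃.mul hv₂)).prodMk (((hu₃.mul hv₁).sub (hu₁.mul hv₃)).prodMk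
    ((hu₁.mul hv₂).sub (hu₂.mul hv₁)))).congr_deriv ?_
  ext <;> simp [_root_.crossE] <;> ring

theorem HasDerivAt.innerZ {u v : ℝ → V3} {u' v' : V3} {s : ℝ}
    (hu : HasDerivAt u u' s) (hv : HasDerivAt v v' s) :
    HasDerivAt (fun r => innerZ (u r) (v r)) (innerZ u' (v s) + innerZ (u s) v') s := by
  obtain ⟨hu₁, hu₂, -⟩ := hu.coordinates
  obtain ⟨hv₁, hv₂, -⟩ := hv.coordinates
  refine ((hu₁.mul hv₁).add (hu₂.mul hv₂)).congr_deriv ?_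
  simp only [_root_.innerZ]
  ring

theorem linearIndependent_of_det3_ne_zero {u v w : V3} (h : det3 u v w ≠ 0) :
    LinearIndependent ℝ ![u, v, w] := by
  rw [Fintype.linearIndependent_iff]
  intro g hg
  simp only [Fin.sum_univ_three, Matrix.cons_val, Prod.ext_iff, Prod.fst_add, Prod.snd_add,
    Prod.smul_fst, Prod.smul_snd, smul_eq_mul, Prod.fst_zero, Prod.snd_zero] at hg
  obtain ⟨h₁, h₂, h₃⟩ := hg
  have hg₀ : g 0 * det3 u v w = 0 := by
    simp only [det3]
    linear_combination (v.2.1 * w.2.2 - v.2.2 * w.2.1) * h₁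
      - (v.1 * w.2.2 - v.2.2 * w.1) * h₂ + (v.1 * w.2.1 - v.2.1 * w.1) * h₃
  have hg₁ : g 1 * det3 u v w = 0 := by
    simp only [det3]
    linear_combination (w.2.1 * u.2.2 - w.2.2 * u.2.1) * h₁
      - (w.1 * u.2.2 - w.2.2 * u.1) * h₂ + (w.1 * u.2.1 - w.2.1 * u.1) * h₃
  have hg₂ : g 2 * det3 u v w = 0 := by
    simp only [det3]
    linear_combination (u.2.1 * v.2.2 - u.2.2 * v.2.1) * h₁
      - (u.1 * v.2.2 - u.2.2 * v.1) * h₂ + (u.1 * v.2.1 - u.2.1 * v.1) * h₃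
  intro i
  fin_cases i
  · exact (mul_eq_zero.mp hg₀).resolve_right h
  · exact (mul_eq_zero.mp hg₁).resolve_right h
  · exact (mul_eq_zero.mp hg₂).resolve_right h

/-- The RM bivectors 𝒯 = n₁ × n₂, 𝒩₁ = n₂ × t, 𝒩₂ = t × n₁ along a unit-speed admissible
curve in I³ form a basis of ℝ³ with determinant 1 and satisfy 𝒯' = κ₁ 𝒩₁,
𝒩₁' = -κ₁ 𝒯, 𝒩₂' = -κ₂ 𝒯. -/
theorem stmt_5
    (I : Set ℝ) (hI : ∃ a b : ℝ, I = Set.Ioo a b)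
    (α : ℝ → V3) (hα : ContDiff ℝ (⊤ : ℕ∞) α)
    (x y z : ℝ → ℝ) (hcomp : ∀ s, α s = (x s, y s, z s))
    (hunit : ∀ s ∈ I, (deriv x s) ^ 2 + (deriv y s) ^ 2 = 1)
    (κ : ℝ → ℝ)
    (hκdef : ∀ s, κ s = deriv x s * deriv (deriv y) s - deriv (deriv x) s * deriv y s)
    (hadm : ∀ s ∈ I, κ s ≠ 0)
    (t : ℝ → V3) (ht : ∀ s, t s = deriv α s)
    (b : V3) (hb : b = ((0 : ℝ), (0 : ℝ), (1 : ℝ)))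
    (n₁ : ℝ → V3) (hn₁d : ∀ s ∈ I, DifferentiableAt ℝ n₁ s)
    (hn₁t : ∀ s ∈ I, innerZ (n₁ s) (t s) = 0)
    (hn₁n₁ : ∀ s ∈ I, innerZ (n₁ s) (n₁ s) = 1)
    (hdet : ∀ s ∈ I, det3 (t s) (n₁ s) b = 1)
    (hRM : ∀ s ∈ I, ∃ μ : ℝ, deriv n₁ s = μ • t s)
    (κ₁ κ₂ : ℝ → ℝ)
    (hnat : ∀ s ∈ I, deriv t s = κ₁ s • n₁ s + κ₂ s • b)
    (T N₁ N₂ : ℝ → V3)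
    (hT : ∀ s, T s = crossE (n₁ s) b)
    (hN₁ : ∀ s, N₁ s = crossE b (t s))
    (hN₂ : ∀ s, N₂ s = crossE (t s) (n₁ s)) :
    ∀ s ∈ I,
      LinearIndependent ℝ ![T s, N₁ s, N₂ s] ∧
      det3 (T s) (N₁ s) (N₂ s) = 1 ∧
      deriv T s = κ₁ s • N₁ s ∧
      deriv N₁ s = (-(κ₁ s)) • T s ∧
      deriv N₂ s = (-(κ₂ s)) • T s := by
  intro s hs
  have hI_nhds : I ∈ nhds s := by
    obtain ⟨c, d, rfl⟩ := hI
    exact isOpen_Ioo.mem_nhds hs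
  obtain ⟨μ, hμ⟩ := hRM s hs
  have hn : HasDerivAt n₁ (μ • t s) s := hμ ▸ (hn₁d s hs).hasDerivAt
  have htd : DifferentiableAt ℝ t s := by
    rw [funext ht]
    exact ((contDiff_infty_iff_deriv.mp hα).2.differentiable (by simp)).differentiableAt
  have htd' : HasDerivAt t (κ₁ s • n₁ s + κ₂ s • b) s := hnat s hs ▸ htd.hasDerivAt
  have hort := hn₁t s hs
  have hnn := hn₁n₁ s hs
  have hd := hdet s hs
  have horth' : innerZ (μ • t s) (t s) + innerZ (n₁ s) (κ₁ s • n₁ s + κ₂ s • b) = 0 :=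
    (hn.innerZ htd').unique ((hasDerivAt_const s (0 : ℝ)).congr_of_eventuallyEq
      (Filter.eventually_of_mem hI_nhds hn₁t))
  have hTd := hn.crossE (hasDerivAt_const s b)
  have hN₁d := (hasDerivAt_const s b).crossE htd'
  have hN₂d := htd'.crossE hn
  rw [← funext hT] at hTd
  rw [← funext hN₁] at hN₁d
  rw [← funext hN₂] at hN₂d
  subst hb
  simp only [innerZ, det3, Prod.fst_add, Prod.snd_add, Prod.smul_fst, Prod.smul_snd,
    smul_eq_mul, mul_zero, mul_one, add_zero, sub_zero] at hort hnn hd horth'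
  have htx : (t s).1 = (n₁ s).2.1 := by
    linear_combination (n₁ s).2.1 * hd + (n₁ s).1 * hort - (t s).1 * hnn
  have hty : (t s).2.1 = -(n₁ s).1 := by
    linear_combination -(n₁ s).1 * hd + (n₁ s).2.1 * hort - (t s).2.1 * hnn
  have hμκ : μ = -κ₁ s := by
    rw [htx, hty] at horth'
    linear_combination horth' - (μ + κ₁ s) * hnn
  have hdetT : det3 (T s) (N₁ s) (N₂ s) = 1 := by
    rw [hT, hN₁, hN₂]
    simp only [det3, crossE, htx, hty]
    linear_combination ((n₁ s).1 * (n₁ s).1 + (n₁ s).2.1 * (n₁ s).2.1 + 1) * hnn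
  refine ⟨linearIndependent_of_det3_ne_zero (hdetT ▸ one_ne_zero), hdetT, ?_, ?_, ?_⟩
  · rw [hTd.deriv, hN₁, hμκ]
    ext <;> simp [crossE]
  · rw [hN₁d.deriv, hT]
    ext <;> simp [crossE]
  · rw [hN₂d.deriv, hT]
    ext <;> simp [crossE] <;> ring
end
end

section
/- Let α : I → ℝ³ be a unit-speed admissible curve in the simply isotropic space I³ with isotropic curvature κ, and let r > 0. Then α lies on an isotropic sphere of cylindrical type of radius r, i.e., there exists P ∈ ℝ³ with ⟨α(s) − P, α(s) − P⟩_z = r² for all s ∈ I, if and only if κ is constant on I and |κ| = 1/r. -/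
noncomputable section

/-- If `f` and `g` agree on an open set, so do their derivatives. -/
theorem HasDerivAt.eq_of_eqOn_isOpen {f g : ℝ → ℝ} {f' g' s : ℝ} {I : Set ℝ} (hI : IsOpen I)
    (hs : s ∈ I) (h : Set.EqOn f g I) (hf : HasDerivAt f f' s) (hg : HasDerivAt g g' s) :
    f' = g' :=
  (hf.congr_of_eventuallyEq (h.symm.eventuallyEq_of_mem (hI.mem_nhds hs))).unique hg

/-- A function whose derivative vanishes on an open interval is constant there. -/
theorem eq_of_hasDerivAt_zero_of_Ioo {f : ℝ → ℝ} {a b : ℝ}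
    (h : ∀ s ∈ Set.Ioo a b, HasDerivAt f 0 s) {s s' : ℝ} (hs : s ∈ Set.Ioo a b)
    (hs' : s' ∈ Set.Ioo a b) : f s = f s' :=
  isOpen_Ioo.is_const_of_deriv_eq_zero isPreconnected_Ioo
    (fun u hu => (h u hu).differentiableAt.differentiableWithinAt)
    (fun u hu => (h u hu).deriv) hs hs'

/-- A unit-speed admissible curve in I³ lies on an isotropic sphere of cylindrical type of
radius r iff its isotropic curvature κ is constant with |κ| = 1/r. -/
theorem stmt_6
    (I : Set ℝ) (hI : ∃ a b : ℝ, I = Set.Ioo a b)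
    (α : ℝ → V3) (hα : ContDiff ℝ (⊤ : ℕ∞) α)
    (x y z : ℝ → ℝ) (hcomp : ∀ s, α s = (x s, y s, z s))
    (hunit : ∀ s ∈ I, (deriv x s) ^ 2 + (deriv y s) ^ 2 = 1)
    (κ : ℝ → ℝ)
    (hκdef : ∀ s, κ s = deriv x s * deriv (deriv y) s - deriv (deriv x) s * deriv y s)
    (hadm : ∀ s ∈ I, κ s ≠ 0)
    (t : ℝ → V3) (ht : ∀ s, t s = deriv α s)
    (b : V3) (hb : b = ((0 : ℝ), (0 : ℝ), (1 : ℝ)))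
    (r : ℝ) (hr : 0 < r) :
    (∃ P : V3, ∀ s ∈ I, innerZ (α s - P) (α s - P) = r ^ 2) ↔
      ((∀ s ∈ I, ∀ s' ∈ I, κ s = κ s') ∧ ∀ s ∈ I, |κ s| = 1 / r) := by
  obtain ⟨a, c, rfl⟩ := hI
  have hx : ContDiff ℝ (⊤ : ℕ∞) x := by
    have h : x = fun s => (α s).1 := by ext s; simp [hcomp]
    rw [h]; exact hα.fst
  have hy : ContDiff ℝ (⊤ : ℕ∞) y := by
    have h : y = fun s => (α s).2.1 := by ext s; simp [hcomp]
    rw [h]; exact hα.snd.fst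
  have hx' : ContDiff ℝ (⊤ : ℕ∞) (deriv x) := (contDiff_infty_iff_deriv.1 hx).2
  have hy' : ContDiff ℝ (⊤ : ℕ∞) (deriv y) := (contDiff_infty_iff_deriv.1 hy).2
  have hx'' : Continuous (deriv (deriv x)) := (contDiff_infty_iff_deriv.1 hx').2.continuous
  have hy'' : Continuous (deriv (deriv y)) := (contDiff_infty_iff_deriv.1 hy').2.continuous
  have dx : ∀ s, HasDerivAt x (deriv x s) s :=
    fun s => (hx.differentiable (by simp) s).hasDerivAt
  have dy : ∀ s, HasDerivAt y (deriv y s) s :=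
    fun s => (hy.differentiable (by simp) s).hasDerivAt
  have dx' : ∀ s, HasDerivAt (deriv x) (deriv (deriv x) s) s :=
    fun s => (hx'.differentiable (by simp) s).hasDerivAt
  have dy' : ∀ s, HasDerivAt (deriv y) (deriv (deriv y) s) s :=
    fun s => (hy'.differentiable (by simp) s).hasDerivAt
  have horth : ∀ s ∈ Set.Ioo a c,
      deriv x s * deriv (deriv x) s + deriv y s * deriv (deriv y) s = 0 := by
    intro s hs
    have h := HasDerivAt.eq_of_eqOn_isOpen isOpen_Ioo hs hunit
      (((dx' s).pow 2).add ((dy' s).pow 2)) (hasDerivAt_const s 1)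
    norm_num at h
    linarith
  have hinner : ∀ (P : V3) (s : ℝ),
      innerZ (α s - P) (α s - P) = (x s - P.1) ^ 2 + (y s - P.2.1) ^ 2 := by
    intro P s
    simp only [innerZ, hcomp, Prod.fst_sub, Prod.snd_sub]
    ring
  simp only [hinner]
  constructor
  · rintro ⟨P, hP⟩
    have h₁ : ∀ s ∈ Set.Ioo a c,
        (x s - P.1) * deriv x s + (y s - P.2.1) * deriv y s = 0 := by
      intro s hs
      have h := HasDerivAt.eq_of_eqOn_isOpen isOpen_Ioo hs hP
        ((((dx s).sub_const P.1).pow 2).add (((dy s).sub_const P.2.1).pow 2))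
        (hasDerivAt_const s (r ^ 2))
      norm_num at h
      linarith
    have h₂ : ∀ s ∈ Set.Ioo a c,
        1 + (x s - P.1) * deriv (deriv x) s + (y s - P.2.1) * deriv (deriv y) s = 0 := by
      intro s hs
      have h := HasDerivAt.eq_of_eqOn_isOpen isOpen_Ioo hs h₁
        ((((dx s).sub_const P.1).mul (dx' s)).add (((dy s).sub_const P.2.1).mul (dy' s)))
        (hasDerivAt_const s 0)
      linarith [hunit s hs]
    have hsq : ∀ s ∈ Set.Ioo a c, κ s ^ 2 = (1 / r) ^ 2 := by
      intro s hs
      have hu := hunit s hs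
      have e₀ := hP s hs
      have e₁ := h₁ s hs
      have e₂ := h₂ s hs
      have hk := hκdef s
      set w := deriv x s * (y s - P.2.1) - deriv y s * (x s - P.1) with hw
      have eu : x s - P.1 = -w * deriv y s := by
        rw [hw]; linear_combination (-(x s - P.1)) * hu + deriv x s * e₁
      have ev : y s - P.2.1 = w * deriv x s := by
        rw [hw]; linear_combination (-(y s - P.2.1)) * hu + deriv y s * e₁
      have hwr : w ^ 2 = r ^ 2 := by
        rw [eu, ev] at e₀
        linear_combination e₀ - w ^ 2 * hu
      have hwk : w * κ s = -1 := by
        rw [eu, ev] at e₂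
        rw [hk]; linear_combination e₂
      have : r ^ 2 * κ s ^ 2 = 1 := by
        rw [← hwr]; linear_combination (w * κ s - 1) * hwk
      field_simp
      linarith
    have hκ : Continuous κ := by
      rw [funext hκdef]
      exact (hx'.continuous.mul hy'').sub (hx''.mul hy'.continuous)
    refine ⟨fun s hs s' hs' => ?_, fun s hs => ?_⟩
    · exact isPreconnected_Ioo.eq_of_sq_eq (g := fun _ => κ s') hκ.continuousOn
        continuousOn_const (fun u hu => (hsq u hu).trans (hsq s' hs').symm)
        (fun _ => hadm s' hs') hs' rfl hs
    · rw [← abs_of_pos (one_div_pos.2 hr)]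
      exact (sq_eq_sq_iff_abs_eq_abs _ _).1 (hsq s hs)
  · rintro ⟨hconst, habs⟩
    rcases (Set.Ioo a c).eq_empty_or_nonempty with he | ⟨s₀, hs₀⟩
    · exact ⟨0, by simp [he]⟩
    have hk₀ := hadm s₀ hs₀
    set k := κ s₀ with hk
    have hx₂ : ∀ s ∈ Set.Ioo a c, deriv (deriv x) s = -k * deriv y s := by
      intro s hs
      rw [hk, hconst s₀ hs₀ s hs, hκdef]
      linear_combination (-deriv (deriv x) s) * hunit s hs + deriv x s * horth s hs
    have hy₂ : ∀ s ∈ Set.Ioo a c, deriv (deriv y) s = k * deriv x s := by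
      intro s hs
      rw [hk, hconst s₀ hs₀ s hs, hκdef]
      linear_combination (-deriv (deriv y) s) * hunit s hs + deriv y s * horth s hs
    have hp : ∀ s ∈ Set.Ioo a c, HasDerivAt (fun s => x s - deriv y s / k) 0 s := by
      intro s hs
      refine ((dx s).sub ((dy' s).div_const k)).congr_deriv ?_
      rw [hy₂ s hs]; field_simp; ring
    have hq : ∀ s ∈ Set.Ioo a c, HasDerivAt (fun s => y s + deriv x s / k) 0 s := by
      intro s hs
      refine ((dy s).add ((dx' s).div_const k)).congr_deriv ?_
      rw [hx₂ s hs]; field_simp; ring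
    refine ⟨(x s₀ - deriv y s₀ / k, y s₀ + deriv x s₀ / k, 0), fun s hs => ?_⟩
    have hps := eq_of_hasDerivAt_zero_of_Ioo hp hs₀ hs
    have hqs := eq_of_hasDerivAt_zero_of_Ioo hq hs₀ hs
    have hkr : r ^ 2 = 1 / k ^ 2 := by
      rw [← sq_abs k, habs s₀ hs₀]; field_simp
    simp only at hps hqs ⊢
    rw [hps, hqs, hkr, ← hunit s hs]
    field_simp
    ring
end
end

section
/- Let α : I → ℝ³ be a C⁴ unit-speed admissible curve in the simply isotropic space I³ with RM frame {t, n₁, n₂ = b} and natural curvatures κ₁, κ₂. Then α lies on a simply isotropic sphere—i.e., there exist c₁, c₂, c₃, c₄ ∈ ℝ such that x(s)² + y(s)² + 2c₁x(s) + 2c₂y(s) + 2c₃z(s) + c₄ = 0 for all s ∈ I—if and only if the normal development (κ₁(s), κ₂(s)) lies on a line not passing through the origin, i.e., there exist constants a₁, a₂ ∈ ℝ with a₁κ₁(s) + a₂κ₂(s) = 1 for all s ∈ I. -/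
noncomputable section

theorem exists_eq_const_of_hasDerivAt_zero {I : Set ℝ} (hIo : IsOpen I) (hIc : IsPreconnected I)
    {f : ℝ → ℝ} (hf : ∀ s ∈ I, HasDerivAt f 0 s) : ∃ c, ∀ s ∈ I, f s = c :=
  hIo.exists_is_const_of_deriv_eq_zero hIc
    (fun s hs => (hf s hs).differentiableAt.differentiableWithinAt)
    (fun s hs => (hf s hs).deriv)

theorem hasDerivAt_eq_zero_of_eqOn_zero {I : Set ℝ} (hIo : IsOpen I) {f : ℝ → ℝ} {f' s : ℝ}
    (hf : ∀ u ∈ I, f u = 0) (hs : s ∈ I) (h : HasDerivAt f f' s) : f' = 0 :=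
  h.unique ((hasDerivAt_const s (0 : ℝ)).congr_of_eventuallyEq
    (Filter.eventually_of_mem (hIo.mem_nhds hs) hf))

/-- The scalar form of the isotropic RM frame equations: `(x', y', z') = (p, q, r)` is the unit
tangent, the first RM normal is `(-q, p, w)`, and the natural curvatures are `κ₁, κ₂`. -/
theorem spherical_iff_of_scalar_frame {I : Set ℝ} (hIo : IsOpen I) (hIc : IsPreconnected I)
    {x y z p q r w κ₁ κ₂ : ℝ → ℝ}
    (hx : ∀ s ∈ I, HasDerivAt x (p s) s) (hy : ∀ s ∈ I, HasDerivAt y (q s) s)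
    (hz : ∀ s ∈ I, HasDerivAt z (r s) s)
    (hunit : ∀ s ∈ I, p s ^ 2 + q s ^ 2 = 1)
    (hp : ∀ s ∈ I, HasDerivAt p (-(κ₁ s * q s)) s) (hq : ∀ s ∈ I, HasDerivAt q (κ₁ s * p s) s)
    (hr : ∀ s ∈ I, HasDerivAt r (κ₁ s * w s + κ₂ s) s)
    (hw : ∀ s ∈ I, HasDerivAt w (-(κ₁ s * r s)) s) :
    (∃ c₁ c₂ c₃ c₄ : ℝ, ∀ s ∈ I,
        x s ^ 2 + y s ^ 2 + 2 * c₁ * x s + 2 * c₂ * y s + 2 * c₃ * z s + c₄ = 0) ↔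
      (∃ a₁ a₂ : ℝ, ∀ s ∈ I, a₁ * κ₁ s + a₂ * κ₂ s = 1) := by
  have sphere_deriv (c₁ c₂ c₃ : ℝ) : ∀ s ∈ I, HasDerivAt
      (fun s => x s ^ 2 + y s ^ 2 + 2 * c₁ * x s + 2 * c₂ * y s + 2 * c₃ * z s)
      (2 * ((x s + c₁) * p s + (y s + c₂) * q s + c₃ * r s)) s := by
    intro s hs
    refine ((((((hx s hs).pow 2).add ((hy s hs).pow 2)).add ((hx s hs).const_mul (2 * c₁))).add
      ((hy s hs).const_mul (2 * c₂))).add ((hz s hs).const_mul (2 * c₃))).congr_deriv ?_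
    norm_num
    ring
  constructor
  · rintro ⟨c₁, c₂, c₃, c₄, hF⟩
    have tangent : ∀ s ∈ I, (x s + c₁) * p s + (y s + c₂) * q s + c₃ * r s = 0 := by
      intro s hs
      have h := hasDerivAt_eq_zero_of_eqOn_zero hIo hF hs ((sphere_deriv c₁ c₂ c₃ s hs).add_const c₄)
      linarith
    obtain ⟨A, hA⟩ := exists_eq_const_of_hasDerivAt_zero hIo hIc
      (f := fun s => -((x s + c₁) * q s) + (y s + c₂) * p s + c₃ * w s) fun s hs => by
        refine (((((hx s hs).add_const c₁).mul (hq s hs)).neg.add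
          (((hy s hs).add_const c₂).mul (hp s hs))).add ((hw s hs).const_mul c₃)).congr_deriv ?_
        linear_combination (-κ₁ s) * tangent s hs
    refine ⟨-A, -c₃, fun s hs => ?_⟩
    have h := hasDerivAt_eq_zero_of_eqOn_zero hIo tangent hs
      (((((hx s hs).add_const c₁).mul (hp s hs)).add
        (((hy s hs).add_const c₂).mul (hq s hs))).add ((hr s hs).const_mul c₃))
    linear_combination κ₁ s * hA s hs - h + hunit s hs
  · rintro ⟨a₁, a₂, hline⟩
    obtain ⟨m₁, hm₁⟩ := exists_eq_const_of_hasDerivAt_zero hIo hIc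
      (f := fun s => x s - (a₂ * (r s * p s) + (a₁ - a₂ * w s) * q s)) fun s hs => by
        refine ((hx s hs).sub ((((hr s hs).mul (hp s hs)).const_mul a₂).add
          ((((hw s hs).const_mul a₂).const_sub a₁).mul (hq s hs)))).congr_deriv ?_
        linear_combination (-p s) * hline s hs
    obtain ⟨m₂, hm₂⟩ := exists_eq_const_of_hasDerivAt_zero hIo hIc
      (f := fun s => y s - (a₂ * (r s * q s) - (a₁ - a₂ * w s) * p s)) fun s hs => by
        refine ((hy s hs).sub ((((hr s hs).mul (hq s hs)).const_mul a₂).sub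
          ((((hw s hs).const_mul a₂).const_sub a₁).mul (hp s hs)))).congr_deriv ?_
        linear_combination (-q s) * hline s hs
    obtain ⟨c, hc⟩ := exists_eq_const_of_hasDerivAt_zero hIo hIc fun s hs => by
      refine (sphere_deriv (-m₁) (-m₂) (-a₂) s hs).congr_deriv ?_
      linear_combination 2 * p s * hm₁ s hs + 2 * q s * hm₂ s hs + 2 * a₂ * r s * hunit s hs
    exact ⟨-m₁, -m₂, -a₂, -c, fun s hs => by linarith [hc s hs]⟩

theorem HasDerivAt.prod_components {f : ℝ → V3} {v : V3} {s : ℝ} (h : HasDerivAt f v s) :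
    HasDerivAt (fun s => (f s).1) v.1 s ∧ HasDerivAt (fun s => (f s).2.1) v.2.1 s ∧
      HasDerivAt (fun s => (f s).2.2) v.2.2 s := by
  have h₁ := h.hasFDerivAt.fst.hasDerivAt
  have h₂ := h.hasFDerivAt.snd.fst.hasDerivAt
  have h₃ := h.hasFDerivAt.snd.snd.hasDerivAt
  exact ⟨by simpa using h₁, by simpa using h₂, by simpa using h₃⟩

/-- A C⁴ unit-speed admissible curve in I³ lies on a simply isotropic sphere iff its
normal development (κ₁, κ₂) lies on a line not passing through the origin. -/
theorem stmt_7
    (I : Set ℝ) (hI : ∃ a b : ℝ, I = Set.Ioo a b)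
    (α : ℝ → V3) (hα : ContDiff ℝ 4 α)
    (x y z : ℝ → ℝ) (hcomp : ∀ s, α s = (x s, y s, z s))
    (hunit : ∀ s ∈ I, (deriv x s) ^ 2 + (deriv y s) ^ 2 = 1)
    (κ : ℝ → ℝ)
    (hκdef : ∀ s, κ s = deriv x s * deriv (deriv y) s - deriv (deriv x) s * deriv y s)
    (hadm : ∀ s ∈ I, κ s ≠ 0)
    (t : ℝ → V3) (ht : ∀ s, t s = deriv α s)
    (b : V3) (hb : b = ((0 : ℝ), (0 : ℝ), (1 : ℝ)))
    (n₁ : ℝ → V3) (hn₁d : ∀ s ∈ I, DifferentiableAt ℝ n₁ s)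
    (hn₁t : ∀ s ∈ I, innerZ (n₁ s) (t s) = 0)
    (hn₁n₁ : ∀ s ∈ I, innerZ (n₁ s) (n₁ s) = 1)
    (hdet : ∀ s ∈ I, det3 (t s) (n₁ s) b = 1)
    (hRM : ∀ s ∈ I, ∃ μ : ℝ, deriv n₁ s = μ • t s)
    (κ₁ κ₂ : ℝ → ℝ)
    (hnat : ∀ s ∈ I, deriv t s = κ₁ s • n₁ s + κ₂ s • b)
    :
    (∃ c₁ c₂ c₃ c₄ : ℝ, ∀ s ∈ I,
        x s ^ 2 + y s ^ 2 + 2 * c₁ * x s + 2 * c₂ * y s + 2 * c₃ * z s + c₄ = 0) ↔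
      (∃ a₁ a₂ : ℝ, ∀ s ∈ I, a₁ * κ₁ s + a₂ * κ₂ s = 1) := by
  obtain ⟨l, u, rfl⟩ := hI
  have htα : t = deriv α := funext ht
  have hx : x = fun s => (α s).1 := funext fun s => by simp [hcomp]
  have hy : y = fun s => (α s).2.1 := funext fun s => by simp [hcomp]
  have hz : z = fun s => (α s).2.2 := funext fun s => by simp [hcomp]
  have hα' (s : ℝ) : HasDerivAt α (t s) s :=
    ht s ▸ (hα.differentiable (by norm_num) s).hasDerivAt
  have ht' (s : ℝ) : HasDerivAt t (deriv t s) s := by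
    have h : ContDiff ℝ 1 (deriv α) :=
      (contDiff_succ_iff_deriv.1 (hα.of_le (by norm_num : (1 + 1 : WithTop ℕ∞) ≤ 4))).2.2
    exact htα ▸ (h.differentiable one_ne_zero s).hasDerivAt
  have hxd (s : ℝ) : HasDerivAt x (t s).1 s := hx ▸ (hα' s).prod_components.1
  have hyd (s : ℝ) : HasDerivAt y (t s).2.1 s := hy ▸ (hα' s).prod_components.2.1
  have hzd (s : ℝ) : HasDerivAt z (t s).2.2 s := hz ▸ (hα' s).prod_components.2.2
  have hunit' : ∀ s ∈ Set.Ioo l u, (t s).1 ^ 2 + (t s).2.1 ^ 2 = 1 := fun s hs => by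
    rw [← (hxd s).deriv, ← (hyd s).deriv]
    exact hunit s hs
  have hn : ∀ s ∈ Set.Ioo l u, (n₁ s).1 = -(t s).2.1 ∧ (n₁ s).2.1 = (t s).1 := by
    intro s hs
    have h₁ := hn₁t s hs
    have h₂ := hdet s hs
    have h₃ := hunit' s hs
    simp only [innerZ, det3, hb] at h₁ h₂
    constructor
    · linear_combination (t s).1 * h₁ - (t s).2.1 * h₂ - (n₁ s).1 * h₃
    · linear_combination (t s).2.1 * h₁ + (t s).1 * h₂ - (n₁ s).2.1 * h₃
  have hp : ∀ s ∈ Set.Ioo l u, HasDerivAt (fun s => (t s).1) (-(κ₁ s * (t s).2.1)) s :=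
    fun s hs => (ht' s).prod_components.1.congr_deriv (by simp [hnat s hs, hb, (hn s hs).1])
  have hq : ∀ s ∈ Set.Ioo l u, HasDerivAt (fun s => (t s).2.1) (κ₁ s * (t s).1) s :=
    fun s hs => (ht' s).prod_components.2.1.congr_deriv (by simp [hnat s hs, hb, (hn s hs).2])
  refine spherical_iff_of_scalar_frame isOpen_Ioo isPreconnected_Ioo
    (w := fun s => (n₁ s).2.2) (fun s _ => hxd s) (fun s _ => hyd s) (fun s _ => hzd s)
    hunit' hp hq
    (fun s hs => (ht' s).prod_components.2.2.congr_deriv (by simp [hnat s hs, hb])) ?_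
  intro s hs
  obtain ⟨μ, hμ⟩ := hRM s hs
  obtain ⟨hn₁x, hn₁y, hn₁z⟩ := (hμ ▸ (hn₁d s hs).hasDerivAt).prod_components
  have hnear := isOpen_Ioo.mem_nhds hs
  have e₁ := hn₁x.unique ((hq s hs).neg.congr_of_eventuallyEq
    (Filter.eventually_of_mem hnear fun v hv => (hn v hv).1))
  have e₂ := hn₁y.unique ((hp s hs).congr_of_eventuallyEq
    (Filter.eventually_of_mem hnear fun v hv => (hn v hv).2))
  simp only [Prod.smul_fst, Prod.smul_snd, smul_eq_mul] at e₁ e₂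
  have hμκ : μ = -κ₁ s := by
    linear_combination (t s).1 * e₁ + (t s).2.1 * e₂ - (μ + κ₁ s) * hunit' s hs
  exact hn₁z.congr_deriv (by simp [hμκ])
end
end

section
/- Let α : I → ℝ³ be a unit-speed admissible curve in the simply isotropic space I³ with RM frame {t, n₁, n₂ = b} and natural curvatures κ₁, κ₂. Then α lies on a plane—i.e., there exist u ∈ ℝ³, u ≠ 0, and d ∈ ℝ with ⟨α(s), u⟩ = d (standard Euclidean inner product) for all s ∈ I—if and only if its normal development (κ₁(s), κ₂(s)) lies on a line passing through the origin, i.e., there exist constants (a₁, a₂) ≠ (0,0) with a₁κ₁(s) + a₂κ₂(s) = 0 for all s ∈ I; and these conditions are equivalent to the isotropic torsion τ vanishing identically on I. -/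
noncomputable section

/-- The standard Euclidean inner product on ℝ³. -/
def dotE (u v : V3) : ℝ := u.1 * v.1 + u.2.1 * v.2.1 + u.2.2 * v.2.2

/-- A function with vanishing derivative on an open interval is constant there. -/
theorem exists_const_of_hasDerivAt_zero {I : Set ℝ} (hI : ∃ a b : ℝ, I = Set.Ioo a b)
    {f : ℝ → ℝ} (hf : ∀ s ∈ I, HasDerivAt f 0 s) : ∃ c, ∀ s ∈ I, f s = c := by
  obtain ⟨a, b, rfl⟩ := hI
  exact isOpen_Ioo.exists_is_const_of_deriv_eq_zero isPreconnected_Ioo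
    (fun s hs => (hf s hs).differentiableAt.differentiableWithinAt)
    (fun s hs => (hf s hs).deriv)

/-- Two functions agreeing on an open set have the same derivative there. -/
theorem HasDerivAt.unique_of_eqOn {I : Set ℝ} (hI : IsOpen I) {f g : ℝ → ℝ} (hfg : Set.EqOn f g I)
    {s f' g' : ℝ} (hs : s ∈ I) (hf : HasDerivAt f f' s) (hg : HasDerivAt g g' s) : f' = g' :=
  hf.unique (hg.congr_of_eventuallyEq (hfg.eventuallyEq_of_mem (hI.mem_nhds hs)))

/-- The coordinates of a derivative in `V3` are the derivatives of the coordinates. -/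
theorem V3.hasDerivAt_coords {f : ℝ → V3} {f' : V3} {s : ℝ} (hf : HasDerivAt f f' s) :
    HasDerivAt (fun r => (f r).1) f'.1 s ∧ HasDerivAt (fun r => (f r).2.1) f'.2.1 s ∧
      HasDerivAt (fun r => (f r).2.2) f'.2.2 s :=
  ⟨hf.fst, hf.snd.fst, hf.snd.snd⟩

/-- The isotropic Frenet equations in coordinates, where the tangent is `(X, Y, Z)` and the
principal normal is `(-Y, X, p)`. -/
structure FrenetSystem (I : Set ℝ) (X Y Z p κ τ : ℝ → ℝ) : Prop where
  unit : ∀ s ∈ I, X s ^ 2 + Y s ^ 2 = 1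
  curvature_ne_zero : ∀ s ∈ I, κ s ≠ 0
  deriv_X : ∀ s ∈ I, HasDerivAt X (-(κ s * Y s)) s
  deriv_Y : ∀ s ∈ I, HasDerivAt Y (κ s * X s) s
  deriv_Z : ∀ s ∈ I, HasDerivAt Z (κ s * p s) s
  deriv_p : ∀ s ∈ I, HasDerivAt p (-(κ s * Z s) + τ s) s

namespace FrenetSystem

variable {I : Set ℝ} {X Y Z p κ τ x y z : ℝ → ℝ}

theorem torsion_eq_zero_of_planar (h : FrenetSystem I X Y Z p κ τ) (hI : IsOpen I)
    (hx : ∀ s ∈ I, HasDerivAt x (X s) s) (hy : ∀ s ∈ I, HasDerivAt y (Y s) s)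
    (hz : ∀ s ∈ I, HasDerivAt z (Z s) s) {u₁ u₂ u₃ d : ℝ}
    (hu : ¬(u₁ = 0 ∧ u₂ = 0 ∧ u₃ = 0))
    (hd : ∀ s ∈ I, x s * u₁ + y s * u₂ + z s * u₃ = d) : ∀ s ∈ I, τ s = 0 := by
  have htan : ∀ s ∈ I, X s * u₁ + Y s * u₂ + Z s * u₃ = 0 := fun s hs =>
    HasDerivAt.unique_of_eqOn hI hd hs
      ((((hx s hs).mul_const u₁).add ((hy s hs).mul_const u₂)).add ((hz s hs).mul_const u₃))
      (hasDerivAt_const s d)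
  have hnor : ∀ s ∈ I, -Y s * u₁ + X s * u₂ + p s * u₃ = 0 := fun s hs => by
    have key := HasDerivAt.unique_of_eqOn hI htan hs
      ((((h.deriv_X s hs).mul_const u₁).add ((h.deriv_Y s hs).mul_const u₂)).add
        ((h.deriv_Z s hs).mul_const u₃)) (hasDerivAt_const s 0)
    apply mul_left_cancel₀ (h.curvature_ne_zero s hs)
    linear_combination key
  intro s hs
  have key := HasDerivAt.unique_of_eqOn hI hnor hs
    ((((h.deriv_Y s hs).neg.mul_const u₁).add ((h.deriv_X s hs).mul_const u₂)).add
      ((h.deriv_p s hs).mul_const u₃)) (hasDerivAt_const s 0)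
  have hτu : τ s * u₃ = 0 := by linear_combination key + κ s * htan s hs
  refine (mul_eq_zero.mp hτu).resolve_right fun hu₃ => hu ⟨?_, ?_, hu₃⟩
  · linear_combination X s * htan s hs - Y s * hnor s hs - u₁ * h.unit s hs
      - (X s * Z s - Y s * p s) * hu₃
  · linear_combination Y s * htan s hs + X s * hnor s hs - u₂ * h.unit s hs
      - (Y s * Z s + X s * p s) * hu₃

theorem planar_of_torsion_eq_zero (h : FrenetSystem I X Y Z p κ τ)
    (hI : ∃ a b : ℝ, I = Set.Ioo a b)
    (hx : ∀ s ∈ I, HasDerivAt x (X s) s) (hy : ∀ s ∈ I, HasDerivAt y (Y s) s)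
    (hz : ∀ s ∈ I, HasDerivAt z (Z s) s) (hτ : ∀ s ∈ I, τ s = 0) :
    ∃ u₁ u₂ d : ℝ, ∀ s ∈ I, x s * u₁ + y s * u₂ + z s * 1 = d := by
  obtain ⟨u₁, hu₁⟩ := exists_const_of_hasDerivAt_zero hI
    (f := fun s => Y s * p s - Z s * X s) fun s hs => by
      refine (((h.deriv_Y s hs).mul (h.deriv_p s hs)).sub
        ((h.deriv_Z s hs).mul (h.deriv_X s hs))).congr_deriv ?_
      rw [hτ s hs]
      ring
  obtain ⟨u₂, hu₂⟩ := exists_const_of_hasDerivAt_zero hI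
    (f := fun s => -(Z s * Y s) - X s * p s) fun s hs => by
      refine (((h.deriv_Z s hs).mul (h.deriv_Y s hs)).neg.sub
        ((h.deriv_X s hs).mul (h.deriv_p s hs))).congr_deriv ?_
      rw [hτ s hs]
      ring
  refine ⟨u₁, u₂, exists_const_of_hasDerivAt_zero hI fun s hs => ?_⟩
  refine ((((hx s hs).mul_const u₁).add ((hy s hs).mul_const u₂)).add
    ((hz s hs).mul_const 1)).congr_deriv ?_
  rw [← hu₁ s hs, ← hu₂ s hs]
  linear_combination -Z s * h.unit s hs

/-- The quotient of the natural curvatures is a primitive of the torsion; `w` is the last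
coordinate of the rotation minimizing normal. -/
theorem development_iff_torsion (h : FrenetSystem I X Y Z p κ τ)
    (hI : ∃ a b : ℝ, I = Set.Ioo a b) {w κ₁ κ₂ : ℝ → ℝ}
    (hw : ∀ s ∈ I, HasDerivAt w (-(κ s * Z s)) s) (hκ₁ : ∀ s ∈ I, κ₁ s = κ s)
    (hκ₂ : ∀ s ∈ I, κ₂ s = κ s * (p s - w s)) :
    (∃ a₁ a₂ : ℝ, (a₁, a₂) ≠ ((0 : ℝ), (0 : ℝ)) ∧ ∀ s ∈ I, a₁ * κ₁ s + a₂ * κ₂ s = 0) ↔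
      ∀ s ∈ I, τ s = 0 := by
  have hpw : ∀ s ∈ I, HasDerivAt (fun r => p r - w r) (τ s) s := fun s hs => by
    refine ((h.deriv_p s hs).sub (hw s hs)).congr_deriv ?_
    ring
  constructor
  · rintro ⟨a₁, a₂, ha, hline⟩ s hs
    have hline' : ∀ r ∈ I, a₁ + a₂ * (p r - w r) = 0 := fun r hr => by
      apply mul_left_cancel₀ (h.curvature_ne_zero r hr)
      linear_combination hline r hr - a₁ * hκ₁ r hr - a₂ * hκ₂ r hr
    have hopen : IsOpen I := by
      obtain ⟨a, b, rfl⟩ := hI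
      exact isOpen_Ioo
    have key := HasDerivAt.unique_of_eqOn hopen hline' hs
      (((hpw s hs).const_mul a₂).const_add a₁) (hasDerivAt_const s 0)
    refine (mul_eq_zero.mp key).resolve_left fun ha₂ => ha ?_
    have ha₁ : a₁ = 0 := by linear_combination hline' s hs - (p s - w s) * ha₂
    rw [ha₁, ha₂]
  · intro hτ
    obtain ⟨c, hc⟩ := exists_const_of_hasDerivAt_zero hI fun s hs => hτ s hs ▸ hpw s hs
    refine ⟨-c, 1, by simp, fun s hs => ?_⟩
    rw [hκ₁ s hs, hκ₂ s hs, hc s hs]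
    ring

end FrenetSystem

/-- A unit-speed admissible curve in I³ lies on a plane iff its normal development lies on
a line through the origin, and these are equivalent to the vanishing of the torsion. -/
theorem stmt_8
    (I : Set ℝ) (hI : ∃ a b : ℝ, I = Set.Ioo a b)
    (α : ℝ → V3) (hα : ContDiff ℝ (⊤ : ℕ∞) α)
    (x y z : ℝ → ℝ) (hcomp : ∀ s, α s = (x s, y s, z s))
    (hunit : ∀ s ∈ I, (deriv x s) ^ 2 + (deriv y s) ^ 2 = 1)
    (κ : ℝ → ℝ)
    (hκdef : ∀ s, κ s = deriv x s * deriv (deriv y) s - deriv (deriv x) s * deriv y s)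
    (hadm : ∀ s ∈ I, κ s ≠ 0)
    (t : ℝ → V3) (ht : ∀ s, t s = deriv α s)
    (b : V3) (hb : b = ((0 : ℝ), (0 : ℝ), (1 : ℝ)))
    (n : ℝ → V3) (hn : ∀ s, n s = (κ s)⁻¹ • deriv t s)
    (τ : ℝ → ℝ) (hτ : ∀ s ∈ I, deriv n s = (-(κ s)) • t s + τ s • b)
    (n₁ : ℝ → V3) (hn₁d : ∀ s ∈ I, DifferentiableAt ℝ n₁ s)
    (hn₁t : ∀ s ∈ I, innerZ (n₁ s) (t s) = 0)
    (hn₁n₁ : ∀ s ∈ I, innerZ (n₁ s) (n₁ s) = 1)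
    (hdet : ∀ s ∈ I, det3 (t s) (n₁ s) b = 1)
    (hRM : ∀ s ∈ I, ∃ μ : ℝ, deriv n₁ s = μ • t s)
    (κ₁ κ₂ : ℝ → ℝ)
    (hnat : ∀ s ∈ I, deriv t s = κ₁ s • n₁ s + κ₂ s • b)
    :
    ((∃ u : V3, u ≠ 0 ∧ ∃ d : ℝ, ∀ s ∈ I, dotE (α s) u = d) ↔
      (∃ a₁ a₂ : ℝ, (a₁, a₂) ≠ ((0 : ℝ), (0 : ℝ)) ∧ ∀ s ∈ I, a₁ * κ₁ s + a₂ * κ₂ s = 0)) ∧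
    ((∃ a₁ a₂ : ℝ, (a₁, a₂) ≠ ((0 : ℝ), (0 : ℝ)) ∧ ∀ s ∈ I, a₁ * κ₁ s + a₂ * κ₂ s = 0) ↔
      (∀ s ∈ I, τ s = 0)) := by
  have hopen : IsOpen I := by
    obtain ⟨a, b, rfl⟩ := hI
    exact isOpen_Ioo
  have ht_eq : t = deriv α := funext ht
  have hα' : ContDiff ℝ (⊤ : ℕ∞) (deriv α) := (contDiff_infty_iff_deriv.mp hα).2
  have hα'' : ContDiff ℝ (⊤ : ℕ∞) (deriv (deriv α)) := (contDiff_infty_iff_deriv.mp hα').2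
  have hdα : ∀ s, HasDerivAt α (t s) s := fun s =>
    ht s ▸ ((contDiff_infty_iff_deriv.mp hα).1 s).hasDerivAt
  have hdt : ∀ s, HasDerivAt t (deriv t s) s := fun s =>
    ((ht_eq ▸ (contDiff_infty_iff_deriv.mp hα').1) s).hasDerivAt
  have hx : ∀ s, HasDerivAt x (t s).1 s := fun s => by
    simpa only [hcomp] using (V3.hasDerivAt_coords (hdα s)).1
  have hy : ∀ s, HasDerivAt y (t s).2.1 s := fun s => by
    simpa only [hcomp] using (V3.hasDerivAt_coords (hdα s)).2.1
  have hz : ∀ s, HasDerivAt z (t s).2.2 s := fun s => by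
    simpa only [hcomp] using (V3.hasDerivAt_coords (hdα s)).2.2
  have hdx : deriv x = fun s => (t s).1 := funext fun s => (hx s).deriv
  have hdy : deriv y = fun s => (t s).2.1 := funext fun s => (hy s).deriv
  have hX := fun s => (V3.hasDerivAt_coords (hdt s)).1
  have hY := fun s => (V3.hasDerivAt_coords (hdt s)).2.1
  have hZ := fun s => (V3.hasDerivAt_coords (hdt s)).2.2
  have hκ : κ = fun s => (t s).1 * (deriv t s).2.1 - (deriv t s).1 * (t s).2.1 := funext fun s => by
    rw [hκdef, hdx, hdy, (hX s).deriv, (hY s).deriv]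
  have hunit' : ∀ s ∈ I, (t s).1 ^ 2 + (t s).2.1 ^ 2 = 1 := fun s hs => by
    simpa only [hdx, hdy] using hunit s hs
  subst hb
  simp only [innerZ, det3] at hn₁t hdet
  have hn₁x : ∀ s ∈ I, (n₁ s).1 = -(t s).2.1 := fun s hs => by
    linear_combination (t s).1 * hn₁t s hs - (t s).2.1 * hdet s hs - (n₁ s).1 * hunit' s hs
  have hn₁y : ∀ s ∈ I, (n₁ s).2.1 = (t s).1 := fun s hs => by
    linear_combination (t s).2.1 * hn₁t s hs + (t s).1 * hdet s hs - (n₁ s).2.1 * hunit' s hs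
  have htx : ∀ s ∈ I, (deriv t s).1 = -(κ₁ s * (t s).2.1) := fun s hs => by
    simp [hnat s hs, hn₁x s hs]
  have hty : ∀ s ∈ I, (deriv t s).2.1 = κ₁ s * (t s).1 := fun s hs => by
    simp [hnat s hs, hn₁y s hs]
  have htz : ∀ s ∈ I, (deriv t s).2.2 = κ₁ s * (n₁ s).2.2 + κ₂ s := fun s hs => by
    simp [hnat s hs]
  have hκ₁ : ∀ s ∈ I, κ₁ s = κ s := fun s hs => by
    simp only [hκ, htx s hs, hty s hs]
    linear_combination -κ₁ s * hunit' s hs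
  have hpz : ∀ s ∈ I, (deriv t s).2.2 = κ s * (n s).2.2 := fun s hs => by
    simp [hn s, hadm s hs]
  have hnd : ∀ s ∈ I, DifferentiableAt ℝ n s := fun s hs => by
    have hdd : DifferentiableAt ℝ (deriv t) s :=
      (ht_eq ▸ (contDiff_infty_iff_deriv.mp hα'').1) s
    have hκd : DifferentiableAt ℝ κ s := by
      rw [hκ]
      exact ((hX s).differentiableAt.mul hdd.snd.fst).sub (hdd.fst.mul (hY s).differentiableAt)
    rw [show n = fun r => (κ r)⁻¹ • deriv t r from funext hn]
    exact (hκd.inv (hadm s hs)).smul hdd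
  have hsys : FrenetSystem I (fun s => (t s).1) (fun s => (t s).2.1) (fun s => (t s).2.2)
      (fun s => (n s).2.2) κ τ :=
    { unit := hunit'
      curvature_ne_zero := hadm
      deriv_X := fun s hs => by simpa only [htx s hs, hκ₁ s hs] using hX s
      deriv_Y := fun s hs => by simpa only [hty s hs, hκ₁ s hs] using hY s
      deriv_Z := fun s hs => by simpa only [hpz s hs] using hZ s
      deriv_p := fun s hs => by
        simpa [hτ s hs] using (V3.hasDerivAt_coords (hnd s hs).hasDerivAt).2.2 }
  have hw : ∀ s ∈ I, HasDerivAt (fun r => (n₁ r).2.2) (-(κ s * (t s).2.2)) s := fun s hs => by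
    obtain ⟨μ, hμ⟩ := hRM s hs
    have hd := V3.hasDerivAt_coords (hn₁d s hs).hasDerivAt
    rw [hμ] at hd
    have hμx : μ * (t s).1 = -(κ s * (t s).1) :=
      HasDerivAt.unique_of_eqOn hopen hn₁x hs hd.1 (hsys.deriv_Y s hs).neg
    have hμy : μ * (t s).2.1 = -(κ s * (t s).2.1) :=
      HasDerivAt.unique_of_eqOn hopen hn₁y hs hd.2.1 (hsys.deriv_X s hs)
    have hμκ : μ = -κ s := by
      linear_combination (t s).1 * hμx + (t s).2.1 * hμy - (μ + κ s) * hunit' s hs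
    simpa [hμκ] using hd.2.2
  have hdev := hsys.development_iff_torsion hI hw hκ₁ (κ₂ := κ₂) fun s hs => by
    linear_combination hpz s hs - htz s hs - (n₁ s).2.2 * hκ₁ s hs
  refine ⟨Iff.trans ⟨?_, fun h => ?_⟩ hdev.symm, hdev⟩
  · rintro ⟨⟨u₁, u₂, u₃⟩, hu, d, hd⟩
    refine hsys.torsion_eq_zero_of_planar hopen (fun s _ => hx s) (fun s _ => hy s)
      (fun s _ => hz s) (u₁ := u₁) (u₂ := u₂) (u₃ := u₃) (d := d) ?_ ?_
    · rintro ⟨rfl, rfl, rfl⟩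
      exact hu rfl
    · simpa only [dotE, hcomp] using hd
  · obtain ⟨u₁, u₂, d, hd⟩ := hsys.planar_of_torsion_eq_zero hI (fun s _ => hx s)
      (fun s _ => hy s) (fun s _ => hz s) h
    refine ⟨(u₁, u₂, 1), by simp, d, ?_⟩
    simpa only [dotE, hcomp] using hd
end
end

section
/- Let α : I → ℝ³ be a unit-speed admissible curve in the simply isotropic space I³ with Frenet frame {t, n, b}. If n₁ and m₁ are two vector fields along α each satisfying ⟨·, t⟩_z = 0, ⟨·, ·⟩_z = 1, det(t, ·, b) = 1, and each rotation minimizing, then m₁ − n₁ is a constant multiple of b, i.e., there is θ₀ ∈ ℝ with m₁(s) = n₁(s) − θ₀ b for all s ∈ I. -/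
noncomputable section

/-- An isotropic normal field with positive orientation has its top view equal to the
rotation by a right angle of the top view of the unit tangent. -/
theorem topView_eq_of_innerZ_det3 {t v : V3} (ht : t.1 ^ 2 + t.2.1 ^ 2 = 1)
    (hvt : innerZ v t = 0) (hdet : det3 t v (0, 0, 1) = 1) :
    v.1 = -t.2.1 ∧ v.2.1 = t.1 := by
  simp only [innerZ] at hvt
  simp only [det3] at hdet
  constructor
  · linear_combination (-v.1) * ht + t.1 * hvt - t.2.1 * hdet
  · linear_combination (-v.2.1) * ht + t.2.1 * hvt + t.1 * hdet

theorem hasDerivAt_topView {d : ℝ → V3} {v : V3} {s : ℝ} (hd : HasDerivAt d v s) :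
    HasDerivAt (fun r => (d r).1) v.1 s ∧ HasDerivAt (fun r => (d r).2.1) v.2.1 s :=
  ⟨(ContinuousLinearMap.fst ℝ ℝ (ℝ × ℝ)).hasFDerivAt.comp_hasDerivAt s hd,
    ((ContinuousLinearMap.fst ℝ ℝ ℝ).comp
      (ContinuousLinearMap.snd ℝ ℝ (ℝ × ℝ))).hasFDerivAt.comp_hasDerivAt s hd⟩

/-- A field with locally vanishing top view whose derivative is a multiple of a vector with
unit top view has zero derivative: the coefficient vanishes. -/
theorem coeff_eq_zero_of_topView_eventually_eq_zero {d : ℝ → V3} {s c : ℝ} {t : V3}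
    (hd : HasDerivAt d (c • t) s) (ht : t.1 ^ 2 + t.2.1 ^ 2 = 1)
    (h₁ : ∀ᶠ r in nhds s, (d r).1 = 0) (h₂ : ∀ᶠ r in nhds s, (d r).2.1 = 0) :
    c = 0 := by
  have e₁ : c * t.1 = 0 :=
    (hasDerivAt_topView hd).1.unique ((hasDerivAt_const s (0 : ℝ)).congr_of_eventuallyEq h₁)
  have e₂ : c * t.2.1 = 0 :=
    (hasDerivAt_topView hd).2.unique ((hasDerivAt_const s (0 : ℝ)).congr_of_eventuallyEq h₂)
  linear_combination (-c) * ht + t.1 * e₁ + t.2.1 * e₂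

/-- Two rotation minimizing unit normal fields (with the same orientation) along a
unit-speed admissible curve in I³ differ by a constant multiple of b. -/
theorem stmt_9
    (I : Set ℝ) (hI : ∃ a b : ℝ, I = Set.Ioo a b)
    (α : ℝ → V3) (hα : ContDiff ℝ (⊤ : ℕ∞) α)
    (x y z : ℝ → ℝ) (hcomp : ∀ s, α s = (x s, y s, z s))
    (hunit : ∀ s ∈ I, (deriv x s) ^ 2 + (deriv y s) ^ 2 = 1)
    (κ : ℝ → ℝ)
    (hκdef : ∀ s, κ s = deriv x s * deriv (deriv y) s - deriv (deriv x) s * deriv y s)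
    (hadm : ∀ s ∈ I, κ s ≠ 0)
    (t : ℝ → V3) (ht : ∀ s, t s = deriv α s)
    (b : V3) (hb : b = ((0 : ℝ), (0 : ℝ), (1 : ℝ)))
    (n : ℝ → V3) (hn : ∀ s, n s = (κ s)⁻¹ • deriv t s)
    (τ : ℝ → ℝ) (hτ : ∀ s ∈ I, deriv n s = (-(κ s)) • t s + τ s • b)
    (n₁ m₁ : ℝ → V3)
    (hn₁d : ∀ s ∈ I, DifferentiableAt ℝ n₁ s)
    (hn₁t : ∀ s ∈ I, innerZ (n₁ s) (t s) = 0)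
    (hn₁n₁ : ∀ s ∈ I, innerZ (n₁ s) (n₁ s) = 1)
    (hn₁det : ∀ s ∈ I, det3 (t s) (n₁ s) b = 1)
    (hn₁RM : ∀ s ∈ I, ∃ μ : ℝ, deriv n₁ s = μ • t s)
    (hm₁d : ∀ s ∈ I, DifferentiableAt ℝ m₁ s)
    (hm₁t : ∀ s ∈ I, innerZ (m₁ s) (t s) = 0)
    (hm₁m₁ : ∀ s ∈ I, innerZ (m₁ s) (m₁ s) = 1)
    (hm₁det : ∀ s ∈ I, det3 (t s) (m₁ s) b = 1)
    (hm₁RM : ∀ s ∈ I, ∃ μ : ℝ, deriv m₁ s = μ • t s) :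
    ∃ θ₀ : ℝ, ∀ s ∈ I, m₁ s = n₁ s - θ₀ • b := by
  obtain ⟨l, r, rfl⟩ := hI
  subst hb
  have htop : ∀ s ∈ Set.Ioo l r, (t s).1 ^ 2 + (t s).2.1 ^ 2 = 1 := by
    intro s hs
    have hd : HasDerivAt α (t s) s := by
      rw [ht]
      exact (hα.differentiable (by simp) s).hasDerivAt
    have hx : HasDerivAt x (t s).1 s := by simpa [hcomp] using (hasDerivAt_topView hd).1
    have hy : HasDerivAt y (t s).2.1 s := by simpa [hcomp] using (hasDerivAt_topView hd).2
    rw [← hx.deriv, ← hy.deriv]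
    exact hunit s hs
  have hdiff : ∀ s ∈ Set.Ioo l r, (m₁ s - n₁ s).1 = 0 ∧ (m₁ s - n₁ s).2.1 = 0 := by
    intro s hs
    have hm := topView_eq_of_innerZ_det3 (htop s hs) (hm₁t s hs) (hm₁det s hs)
    have hn := topView_eq_of_innerZ_det3 (htop s hs) (hn₁t s hs) (hn₁det s hs)
    simp [hm, hn]
  have hderiv : ∀ s ∈ Set.Ioo l r, HasDerivAt (fun s => m₁ s - n₁ s) 0 s := by
    intro s hs
    obtain ⟨μ, hμ⟩ := hm₁RM s hs
    obtain ⟨ν, hν⟩ := hn₁RM s hs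
    have hd : HasDerivAt (fun s => m₁ s - n₁ s) ((μ - ν) • t s) s := by
      rw [sub_smul, ← hμ, ← hν]
      exact (hm₁d s hs).hasDerivAt.sub (hn₁d s hs).hasDerivAt
    have hnhds : Set.Ioo l r ∈ nhds s := isOpen_Ioo.mem_nhds hs
    have hc : μ - ν = 0 := coeff_eq_zero_of_topView_eventually_eq_zero hd (htop s hs)
      (Filter.mem_of_superset hnhds fun u hu => (hdiff u hu).1)
      (Filter.mem_of_superset hnhds fun u hu => (hdiff u hu).2)
    simpa [hc] using hd
  obtain ⟨c, hc⟩ := isOpen_Ioo.exists_is_const_of_deriv_eq_zero isPreconnected_Ioo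
    (fun s hs => (hderiv s hs).differentiableAt.differentiableWithinAt)
    (fun s hs => (hderiv s hs).deriv)
  refine ⟨-c.2.2, fun s hs => ?_⟩
  obtain ⟨h₁, h₂⟩ := hdiff s hs
  have h₃ : m₁ s - n₁ s = c := hc s hs
  rw [h₃] at h₁ h₂
  rw [sub_eq_iff_eq_add'.mp h₃]
  ext <;> simp [h₁, h₂]
end
end

section
/- Let α : I → ℝ³ be a unit-speed admissible curve in the pseudo-isotropic space Iₚ³ with causal sign ε, η = −ε, curvature κ, and Frenet frame {t, n, b}. Then the Frenet bivectors satisfy: n ×₁ b = ε t̃, b ×₁ t = η ñ, and t ×₁ n = (−x*, −y*, 1) = b − (x*, y*, 0), where x* = (ε/κ)(y′z″ − y″z′) and y* = (ε/κ)(x′z″ − x″z′) are the top-view coordinates of the spherical image of α, and ũ denotes the top view (u₁, u₂, 0) of u. -/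
noncomputable section

/-- The pseudo-isotropic inner product ⟨u,v⟩_{z,p} = u₁v₁ - u₂v₂. -/
def innerZP (u v : V3) : ℝ := u.1 * v.1 - u.2.1 * v.2.1

/-- The Lorentz-Minkowski inner product ⟨u,v⟩₁ = u₁v₁ - u₂v₂ + u₃v₃. -/
def dot1 (u v : V3) : ℝ := u.1 * v.1 - u.2.1 * v.2.1 + u.2.2 * v.2.2

/-- The Lorentzian cross product u ×₁ v = (u₂v₃ - u₃v₂, u₁v₃ - u₃v₁, u₁v₂ - u₂v₁). -/
def cross1 (u v : V3) : V3 :=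
  (u.2.1 * v.2.2 - u.2.2 * v.2.1, u.1 * v.2.2 - u.2.2 * v.1, u.1 * v.2.1 - u.2.1 * v.1)

/-- The top view ũ = (u₁, u₂, 0) of a vector u. -/
def tildeV (u : V3) : V3 := (u.1, u.2.1, (0 : ℝ))

theorem hasDerivAt_prodMk_three {x y z : ℝ → ℝ} {s : ℝ} (hx : DifferentiableAt ℝ x s)
    (hy : DifferentiableAt ℝ y s) (hz : DifferentiableAt ℝ z s) :
    HasDerivAt (fun s => ((x s, y s, z s) : V3)) (deriv x s, deriv y s, deriv z s) s :=
  hx.hasDerivAt.prodMk (hy.hasDerivAt.prodMk hz.hasDerivAt)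

/-- Differentiating the unit-speed condition: velocity and acceleration are orthogonal. -/
theorem deriv_mul_deriv_deriv_eq_of_unit_speed {I : Set ℝ} (hI : IsOpen I) {ε : ℝ}
    {x y : ℝ → ℝ} (hx : Differentiable ℝ (deriv x)) (hy : Differentiable ℝ (deriv y))
    (hunit : ∀ s ∈ I, (deriv x s) ^ 2 - (deriv y s) ^ 2 = ε) {s : ℝ} (hs : s ∈ I) :
    deriv x s * deriv (deriv x) s = deriv y s * deriv (deriv y) s := by
  have hd := ((hx s).hasDerivAt.pow 2).sub ((hy s).hasDerivAt.pow 2)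
  have hc : HasDerivAt (deriv x ^ 2 - deriv y ^ 2) 0 s :=
    (hasDerivAt_const s ε).congr_of_eventuallyEq <| by
      filter_upwards [hI.mem_nhds hs] with u hu
      simpa using hunit u hu
  have h := hd.unique hc
  norm_num at h
  linarith

/-- The Frenet bivectors of a unit-speed admissible curve in Iₚ³ satisfy n ×₁ b = ε t̃,
b ×₁ t = η ñ, and t ×₁ n = (-x*, -y*, 1) = b - (x*, y*, 0), where (x*, y*) is the top view
of the spherical image. -/
theorem stmt_13
    (I : Set ℝ) (hI : ∃ a b : ℝ, I = Set.Ioo a b)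
    (ε η : ℝ) (hε : ε = 1 ∨ ε = -1) (hη : η = -ε)
    (α : ℝ → V3) (hα : ContDiff ℝ (⊤ : ℕ∞) α)
    (x y z : ℝ → ℝ) (hcomp : ∀ s, α s = (x s, y s, z s))
    (hunit : ∀ s ∈ I, (deriv x s) ^ 2 - (deriv y s) ^ 2 = ε)
    (hadm : ∀ s ∈ I, deriv x s * deriv (deriv y) s - deriv (deriv x) s * deriv y s ≠ 0)
    (κ : ℝ → ℝ)
    (hκdef : ∀ s, κ s = -ε * (deriv x s * deriv (deriv y) s - deriv (deriv x) s * deriv y s))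
    (t : ℝ → V3) (ht : ∀ s, t s = deriv α s)
    (b : V3) (hb : b = ((0 : ℝ), (0 : ℝ), (1 : ℝ)))
    (n : ℝ → V3) (hn : ∀ s, n s = (η * κ s)⁻¹ • deriv t s)
    (xs ys : ℝ → ℝ)
    (hxs : ∀ s, xs s = (ε / κ s) * (deriv y s * deriv (deriv z) s - deriv (deriv y) s * deriv z s))
    (hys : ∀ s, ys s = (ε / κ s) * (deriv x s * deriv (deriv z) s - deriv (deriv x) s * deriv z s)) :
    ∀ s ∈ I,
      cross1 (n s) b = ε • tildeV (t s) ∧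
      cross1 b (t s) = η • tildeV (n s) ∧
      cross1 (t s) (n s) = ((-(xs s), -(ys s), (1 : ℝ)) : V3) ∧
      cross1 (t s) (n s) = b - ((xs s, ys s, (0 : ℝ)) : V3) := by
  intro s hs
  have hIo : IsOpen I := by
    obtain ⟨a, c, rfl⟩ := hI
    exact isOpen_Ioo
  have hαeq : α = fun s => (x s, y s, z s) := funext hcomp
  have hx : ContDiff ℝ 2 x := by
    have h : ContDiff ℝ (⊤ : ℕ∞) x := by simpa [hαeq] using hα.fst
    exact contDiff_infty.1 h 2
  have hy : ContDiff ℝ 2 y := by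
    have h : ContDiff ℝ (⊤ : ℕ∞) y := by simpa [hαeq] using hα.snd.fst
    exact contDiff_infty.1 h 2
  have hz : ContDiff ℝ 2 z := by
    have h : ContDiff ℝ (⊤ : ℕ∞) z := by simpa [hαeq] using hα.snd.snd
    exact contDiff_infty.1 h 2
  have hx' : Differentiable ℝ (deriv x) := hx.differentiable_deriv_two
  have hy' : Differentiable ℝ (deriv y) := hy.differentiable_deriv_two
  have hz' : Differentiable ℝ (deriv z) := hz.differentiable_deriv_two
  have hteq : t = fun s => (deriv x s, deriv y s, deriv z s) := by
    funext u
    rw [ht, hαeq]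
    exact (hasDerivAt_prodMk_three (hx.differentiable two_ne_zero u)
      (hy.differentiable two_ne_zero u) (hz.differentiable two_ne_zero u)).deriv
  have ht' : deriv t s = (deriv (deriv x) s, deriv (deriv y) s, deriv (deriv z) s) := by
    rw [hteq]
    exact (hasDerivAt_prodMk_three (hx' s) (hy' s) (hz' s)).deriv
  have horth := deriv_mul_deriv_deriv_eq_of_unit_speed hIo hx' hy' hunit hs
  have hu := hunit s hs
  have hW := hadm s hs
  rw [hn, ht', hxs, hys, hκdef, congrFun hteq s, hb, hη]
  generalize deriv (deriv x) s = x₂ at *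
  generalize deriv (deriv y) s = y₂ at *
  generalize deriv (deriv z) s = z₂ at *
  generalize deriv x s = x₁ at *
  generalize deriv y s = y₁ at *
  generalize deriv z s = z₁ at *
  have hε2 : ε * ε = 1 := by rcases hε with rfl | rfl <;> norm_num
  have hε0 : ε ≠ 0 := left_ne_zero_of_mul_eq_one hε2
  obtain ⟨W, hWdef⟩ : ∃ W, W = x₁ * y₂ - x₂ * y₁ := ⟨_, rfl⟩
  rw [← hWdef] at hW ⊢
  have hηκ : -ε * (-ε * W) = W := by linear_combination W * hε2
  have hεκ : ε / (-ε * W) = -W⁻¹ := by field_simp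
  have hy₂ : y₂ = W * (ε * x₁) := by
    linear_combination -y₂ * hε2 - ε * y₂ * hu + ε * y₁ * horth - ε * x₁ * hWdef
  have hx₂ : x₂ = W * (ε * y₁) := by
    linear_combination -x₂ * hε2 - ε * x₂ * hu + ε * x₁ * horth - ε * y₁ * hWdef
  have hny : W⁻¹ * y₂ = ε * x₁ := by rw [hy₂, inv_mul_cancel_left₀ hW]
  have hnx : W⁻¹ * x₂ = ε * y₁ := by rw [hx₂, inv_mul_cancel_left₀ hW]
  have hWW : W⁻¹ * W = 1 := inv_mul_cancel₀ hW
  rw [hηκ, hεκ]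
  simp only [cross1, tildeV, Prod.smul_mk, smul_eq_mul, Prod.mk.injEq, Prod.mk_sub_mk]
  refine ⟨⟨?_, ?_, ?_⟩, ⟨?_, ?_, ?_⟩, ⟨?_, ?_, ?_⟩, ?_, ?_, ?_⟩
  · linear_combination hny
  · linear_combination hnx
  · ring
  · linear_combination ε * hnx + y₁ * hε2
  · linear_combination ε * hny + x₁ * hε2
  · ring
  · ring
  · ring
  · linear_combination hWW - W⁻¹ * hWdef
  · ring
  · ring
  · linear_combination hWW - W⁻¹ * hWdef
end
end

section
/- Let α : I → ℝ³ be a unit-speed admissible curve in the pseudo-isotropic space Iₚ³ with causal sign ε and curvature κ, and define x* = (ε/κ)(y′z″ − y″z′) and y* = (ε/κ)(x′z″ − x″z′). Then the third coordinate of the spherical image satisfies z* := (x*² − y*²)/2 = (ε/(2κ²))(κ² z′² − z″²). -/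
noncomputable section

/-- A plane curve of constant Lorentzian speed has velocity orthogonal to its acceleration. -/
theorem mul_deriv_sub_mul_deriv_eq_zero_of_sq_sub_sq_eq {f g : ℝ → ℝ} {s c : ℝ}
    (hf : DifferentiableAt ℝ f s) (hg : DifferentiableAt ℝ g s)
    (h : (fun r => f r ^ 2 - g r ^ 2) =ᶠ[nhds s] fun _ => c) :
    f s * deriv f s - g s * deriv g s = 0 := by
  have hd := (hf.hasDerivAt.pow 2).sub (hg.hasDerivAt.pow 2)
  have hc := (hasDerivAt_const s c).congr_of_eventuallyEq h
  have := hd.unique hc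
  norm_num at this
  linarith

/-- The algebraic identity behind the formula for the third coordinate: `p`, `q`, `r` are the
components of the velocity and `dp`, `dq`, `dr` those of the acceleration. -/
theorem sphericalImage_third_coord_identity {ε k p q r dp dq dr : ℝ} (hε : ε ^ 2 = 1)
    (hk : k ≠ 0) (hunit : p ^ 2 - q ^ 2 = ε) (horth : p * dp - q * dq = 0)
    (hkdef : k = -ε * (p * dq - dp * q)) :
    ((ε / k * (q * dr - dq * r)) ^ 2 - (ε / k * (p * dr - dp * r)) ^ 2) / 2 =
      ε / (2 * k ^ 2) * (k ^ 2 * r ^ 2 - dr ^ 2) := by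
  have hsq : k ^ 2 = (p * dq - dp * q) ^ 2 := by
    rw [hkdef, mul_pow, neg_sq, hε, one_mul]
  have hacc : dq ^ 2 - dp ^ 2 = ε * k ^ 2 := by
    have hlag : ε * (dq ^ 2 - dp ^ 2) = k ^ 2 := by
      rw [hsq, ← hunit]
      linear_combination (-(p * dp - q * dq)) * horth
    linear_combination ε * hlag - (dq ^ 2 - dp ^ 2) * hε
  field_simp
  linear_combination ε ^ 2 * (-dr ^ 2 * hunit + 2 * r * dr * horth + r ^ 2 * hacc) +
    ε * (k ^ 2 * r ^ 2 - dr ^ 2) * hε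

/-- The third coordinate of the spherical image of a unit-speed admissible curve in Iₚ³
satisfies z* = (x*² - y*²)/2 = (ε/(2κ²))(κ²z'² - z''²). -/
theorem stmt_14
    (I : Set ℝ) (hI : ∃ a b : ℝ, I = Set.Ioo a b)
    (ε η : ℝ) (hε : ε = 1 ∨ ε = -1) (hη : η = -ε)
    (α : ℝ → V3) (hα : ContDiff ℝ (⊤ : ℕ∞) α)
    (x y z : ℝ → ℝ) (hcomp : ∀ s, α s = (x s, y s, z s))
    (hunit : ∀ s ∈ I, (deriv x s) ^ 2 - (deriv y s) ^ 2 = ε)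
    (hadm : ∀ s ∈ I, deriv x s * deriv (deriv y) s - deriv (deriv x) s * deriv y s ≠ 0)
    (κ : ℝ → ℝ)
    (hκdef : ∀ s, κ s = -ε * (deriv x s * deriv (deriv y) s - deriv (deriv x) s * deriv y s))
    (t : ℝ → V3) (ht : ∀ s, t s = deriv α s)
    (b : V3) (hb : b = ((0 : ℝ), (0 : ℝ), (1 : ℝ)))
    (n : ℝ → V3) (hn : ∀ s, n s = (η * κ s)⁻¹ • deriv t s)
    (xs ys : ℝ → ℝ)
    (hxs : ∀ s, xs s = (ε / κ s) * (deriv y s * deriv (deriv z) s - deriv (deriv y) s * deriv z s))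
    (hys : ∀ s, ys s = (ε / κ s) * (deriv x s * deriv (deriv z) s - deriv (deriv x) s * deriv z s)) :
    ∀ s ∈ I,
      (xs s ^ 2 - ys s ^ 2) / 2 =
        (ε / (2 * κ s ^ 2)) * (κ s ^ 2 * (deriv z s) ^ 2 - (deriv (deriv z) s) ^ 2) := by
  intro s hs
  have hx : ContDiff ℝ (⊤ : ℕ∞) x := by
    simpa only [hcomp] using hα.fst
  have hy : ContDiff ℝ (⊤ : ℕ∞) y := by
    simpa only [hcomp] using hα.snd.fst
  have hx' : Differentiable ℝ (deriv x) :=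
    (contDiff_infty_iff_deriv.1 hx).2.differentiable (by simp)
  have hy' : Differentiable ℝ (deriv y) :=
    (contDiff_infty_iff_deriv.1 hy).2.differentiable (by simp)
  have hnhds : I ∈ nhds s := by
    obtain ⟨a, b, rfl⟩ := hI
    exact isOpen_Ioo.mem_nhds hs
  have horth := mul_deriv_sub_mul_deriv_eq_zero_of_sq_sub_sq_eq (hx' s) (hy' s)
    (Filter.eventually_of_mem hnhds hunit)
  have hε2 : ε ^ 2 = 1 := by rcases hε with rfl | rfl <;> norm_num
  have hκ : κ s ≠ 0 := by
    rw [hκdef]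
    refine mul_ne_zero (neg_ne_zero.2 ?_) (hadm s hs)
    rintro rfl
    norm_num at hε
  rw [hxs, hys]
  exact sphericalImage_third_coord_identity hε2 hκ (hunit s hs) horth (hκdef s)
end
end

section
/- Let α : I → ℝ³ be a unit-speed admissible curve in the pseudo-isotropic space Iₚ³ with causal sign ε, η = −ε, and RM frame {t, n₁, n₂ = b} with natural curvatures κ₁, κ₂. Define the RM bivectors via the Lorentzian cross product: 𝒯 = n₁ ×₁ b, 𝒩₁ = b ×₁ t, 𝒩₂ = t ×₁ n₁. Then 𝒯′ = ε κ₁ 𝒩₁, 𝒩₁′ = −η κ₁ 𝒯, and 𝒩₂′ = −κ₂ 𝒯. -/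
noncomputable section

theorem HasDerivAt.v3_fst {u : ℝ → V3} {u' : V3} {s : ℝ} (hu : HasDerivAt u u' s) :
    HasDerivAt (fun r => (u r).1) u'.1 s := by
  simpa using hu.hasFDerivAt.fst.hasDerivAt

theorem HasDerivAt.v3_snd {u : ℝ → V3} {u' : V3} {s : ℝ} (hu : HasDerivAt u u' s) :
    HasDerivAt (fun r => (u r).2.1) u'.2.1 s := by
  simpa using hu.hasFDerivAt.snd.fst.hasDerivAt

theorem HasDerivAt.v3_thd {u : ℝ → V3} {u' : V3} {s : ℝ} (hu : HasDerivAt u u' s) :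
    HasDerivAt (fun r => (u r).2.2) u'.2.2 s := by
  simpa using hu.hasFDerivAt.snd.snd.hasDerivAt

theorem HasDerivAt.innerZP {u v : ℝ → V3} {u' v' : V3} {s : ℝ}
    (hu : HasDerivAt u u' s) (hv : HasDerivAt v v' s) :
    HasDerivAt (fun r => _root_.innerZP (u r) (v r))
      (_root_.innerZP u' (v s) + _root_.innerZP (u s) v') s := by
  refine ((hu.v3_fst.mul hv.v3_fst).sub (hu.v3_snd.mul hv.v3_snd)).congr_deriv ?_
  simp only [_root_.innerZP]
  ring

theorem HasDerivAt.cross1 {u v : ℝ → V3} {u' v' : V3} {s : ℝ}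
    (hu : HasDerivAt u u' s) (hv : HasDerivAt v v' s) :
    HasDerivAt (fun r => _root_.cross1 (u r) (v r))
      (_root_.cross1 u' (v s) + _root_.cross1 (u s) v') s := by
  refine (((hu.v3_snd.mul hv.v3_thd).sub (hu.v3_thd.mul hv.v3_snd)).prodMk
    (((hu.v3_fst.mul hv.v3_thd).sub (hu.v3_thd.mul hv.v3_fst)).prodMk
      ((hu.v3_fst.mul hv.v3_snd).sub (hu.v3_snd.mul hv.v3_fst)))).congr_deriv ?_
  simp only [_root_.cross1, Prod.mk_add_mk, Prod.mk.injEq]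
  refine ⟨?_, ?_, ?_⟩ <;> ring

/-- The RM bivectors 𝒯 = n₁ ×₁ b, 𝒩₁ = b ×₁ t, 𝒩₂ = t ×₁ n₁ along a unit-speed admissible
curve in Iₚ³ satisfy 𝒯' = εκ₁ 𝒩₁, 𝒩₁' = -ηκ₁ 𝒯, 𝒩₂' = -κ₂ 𝒯. -/
theorem stmt_16
    (I : Set ℝ) (hI : ∃ a b : ℝ, I = Set.Ioo a b)
    (ε η : ℝ) (hε : ε = 1 ∨ ε = -1) (hη : η = -ε)
    (α : ℝ → V3) (hα : ContDiff ℝ (⊤ : ℕ∞) α)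
    (x y z : ℝ → ℝ) (hcomp : ∀ s, α s = (x s, y s, z s))
    (hunit : ∀ s ∈ I, (deriv x s) ^ 2 - (deriv y s) ^ 2 = ε)
    (hadm : ∀ s ∈ I, deriv x s * deriv (deriv y) s - deriv (deriv x) s * deriv y s ≠ 0)
    (κ : ℝ → ℝ)
    (hκdef : ∀ s, κ s = -ε * (deriv x s * deriv (deriv y) s - deriv (deriv x) s * deriv y s))
    (t : ℝ → V3) (ht : ∀ s, t s = deriv α s)
    (b : V3) (hb : b = ((0 : ℝ), (0 : ℝ), (1 : ℝ)))
    (n : ℝ → V3) (hn : ∀ s, n s = (η * κ s)⁻¹ • deriv t s)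
    (τ : ℝ → ℝ) (hτ : ∀ s ∈ I, deriv n s = (-ε * κ s) • t s + τ s • b)
    (n₁ : ℝ → V3) (hn₁d : ∀ s ∈ I, DifferentiableAt ℝ n₁ s)
    (hn₁t : ∀ s ∈ I, innerZP (n₁ s) (t s) = 0)
    (hn₁n₁ : ∀ s ∈ I, innerZP (n₁ s) (n₁ s) = η)
    (hdet : ∀ s ∈ I, det3 (t s) (n₁ s) b = det3 (t s) (n s) b)
    (hRM : ∀ s ∈ I, ∃ μ : ℝ, deriv n₁ s = μ • t s)
    (κ₁ κ₂ : ℝ → ℝ)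
    (hnat : ∀ s ∈ I, deriv t s = (η * κ₁ s) • n₁ s + κ₂ s • b)
    (T N₁ N₂ : ℝ → V3)
    (hT : ∀ s, T s = cross1 (n₁ s) b)
    (hN₁ : ∀ s, N₁ s = cross1 b (t s))
    (hN₂ : ∀ s, N₂ s = cross1 (t s) (n₁ s)) :
    ∀ s ∈ I,
      deriv T s = (ε * κ₁ s) • N₁ s ∧
      deriv N₁ s = (-(η * κ₁ s)) • T s ∧
      deriv N₂ s = (-(κ₂ s)) • T s := by
  intro s hs
  obtain ⟨μ, hμ⟩ := hRM s hs
  have hεsq : ε * ε = 1 := by rcases hε with h | h <;> rw [h] <;> norm_num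
  have hαs : HasDerivAt α (t s) s := by
    rw [ht]
    exact (hα.differentiable (by simp) s).hasDerivAt
  have htt : innerZP (t s) (t s) = ε := by
    have hx : deriv x s = (t s).1 := by
      simpa [hcomp] using hαs.v3_fst.deriv
    have hy : deriv y s = (t s).2.1 := by
      simpa [hcomp] using hαs.v3_snd.deriv
    rw [← hunit s hs, hx, hy, innerZP]
    ring
  have hts : HasDerivAt t ((η * κ₁ s) • n₁ s + κ₂ s • b) s := by
    rw [← hnat s hs, funext ht]
    exact ((contDiff_infty_iff_deriv.1 hα).2.differentiable (by simp) s).hasDerivAt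
  have hn₁s : HasDerivAt n₁ (μ • t s) s := hμ ▸ (hn₁d s hs).hasDerivAt
  have hIs : I ∈ nhds s := by
    obtain ⟨c, d, rfl⟩ := hI
    exact isOpen_Ioo.mem_nhds hs
  have hμκ : μ = -(ε * κ₁ s) := by
    have h0 : HasDerivAt (fun r => innerZP (n₁ r) (t r)) 0 s :=
      (hasDerivAt_const s (0 : ℝ)).congr_of_eventuallyEq
        (Filter.eventually_of_mem hIs hn₁t)
    have h := (hn₁s.innerZP hts).unique h0
    have hnn := hn₁n₁ s hs
    have hlin : μ * ε + η * κ₁ s * η = 0 := by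
      rw [← h]
      nth_rewrite 1 [← htt]
      nth_rewrite 2 [← hnn]
      simp [innerZP, hb]
      ring
    subst hη
    linear_combination ε * hlin - (μ + ε * κ₁ s) * hεsq
  have hbs : HasDerivAt (fun _ : ℝ => b) 0 s := hasDerivAt_const s b
  rw [funext hT, funext hN₁, funext hN₂, (hn₁s.cross1 hbs).deriv, (hbs.cross1 hts).deriv,
    (hts.cross1 hn₁s).deriv, hμκ, hb]
  refine ⟨?_, ?_, ?_⟩ <;> ext <;> simp [cross1] <;> ring
end
end
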